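/- arXiv:1601.04370 — 7 statements merged into one kernel-verified Lean document; each statement's English description precedes it below -/
import Mathlib

section
/- The sequence f defined from v = (1,−1,−1) with d = 3 is Apwenian: for every positive integer n, 2^(n−1) divides the Hankel determinant H_n(f) and H_n(f)/2^(n−1) is an odd integer. -/
/-- The Hankel determinant of order `n` of the sequence `c`. -/
def hankel (c : ℕ → ℤ) (n : ℕ) : ℤ :=
  Matrix.det (Matrix.of fun i j : Fin n => c (i.1 + j.1))

section Hankel

open Polynomial

/-- The Riccati equation `A + (X + X²)A' = 1 + X²A²` has no solution `A = P / Q` in rational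
functions over `ZMod 2`. -/
theorem riccati_ne_of_ne_zero {P Q : (ZMod 2)[X]} (hQ : Q ≠ 0) :
    Q * P + (X + X ^ 2) * derivative (Q * P) ≠ Q ^ 2 + X ^ 2 * P ^ 2 := by
  intro h
  set g := EuclideanDomain.gcd Q P with hg
  have hg0 : g ≠ 0 := fun h0 => hQ (EuclideanDomain.gcd_eq_zero_iff.1 h0).1
  obtain ⟨q, hq⟩ : g ∣ Q := EuclideanDomain.gcd_dvd_left Q P
  obtain ⟨p, hp⟩ : g ∣ P := EuclideanDomain.gcd_dvd_right Q P
  obtain ⟨u, v, huv⟩ : ∃ u v, u * q + v * p = 1 := by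
    refine ⟨EuclideanDomain.gcdA Q P, EuclideanDomain.gcdB Q P, mul_left_cancel₀ hg0 ?_⟩
    have := EuclideanDomain.gcd_eq_gcd_ab Q P
    rw [← hg] at this
    linear_combination -this - EuclideanDomain.gcdA Q P * hq - EuclideanDomain.gcdB Q P * hp
  have h2 : (2 : (ZMod 2)[X]) = 0 := CharTwo.two_eq_zero
  have key : q * p + (X + X ^ 2) * derivative (q * p) = q ^ 2 + X ^ 2 * p ^ 2 := by
    refine mul_left_cancel₀ (pow_ne_zero 2 hg0) ?_
    rw [hq, hp] at h
    simp only [derivative_mul] at h ⊢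
    linear_combination h - (X + X ^ 2) * g * derivative g * q * p * h2
  have hx : (1 : ZMod 2) + 1 = 0 := rfl
  have e1 := congrArg (eval 1) key
  have e2 := congrArg (eval 1) huv
  simp only [eval_add, eval_mul, eval_pow, eval_X, eval_one, one_pow, hx, zero_mul, add_zero,
    one_mul] at e1 e2
  generalize eval 1 q = a at *
  generalize eval 1 p = b at *
  generalize eval 1 u = c at *
  generalize eval 1 v = d at *
  revert a b c d
  decide

/-- Truncations of the generating series of a sequence with `d 0 = 1` and
`d (2n + 2) = d (2n + 1) + d n` solve a Riccati equation modulo a power of `X`. -/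
theorem X_pow_dvd_riccati {d : ℕ → ZMod 2} (h0 : d 0 = 1)
    (hd : ∀ n, d (2 * n + 2) = d (2 * n + 1) + d n) (N : ℕ) {S : (ZMod 2)[X]}
    (hS : ∀ k < N, S.coeff k = d k) :
    X ^ N ∣ S + (X + X ^ 2) * derivative S - (1 + X ^ 2 * S ^ 2) := by
  have h2 : (2 : ZMod 2) = 0 := rfl
  rw [X_pow_dvd_iff, ← ZMod.expand_card S]
  rintro (_ | _ | k) hk
  · simp [add_mul, pow_two, mul_assoc, hS 0 hk, h0]
  · simp [add_mul, pow_two, mul_assoc, coeff_derivative, coeff_one, CharTwo.add_self_eq_zero]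
  · have e : ∀ A : (ZMod 2)[X], (X ^ 2 * A).coeff (k + 2) = A.coeff k := fun A => by
      rw [coeff_X_pow_mul]
    have hk' : k + 2 < N := hk
    simp only [coeff_sub, coeff_add, add_mul, e, coeff_X_mul, coeff_derivative,
      coeff_expand two_pos, hS (k + 1) (by omega), hS (k + 1 + 1) (by omega), coeff_one]
    rcases Nat.even_or_odd' k with ⟨j, rfl | rfl⟩
    · rw [if_pos (dvd_mul_right 2 j), Nat.mul_div_cancel_left _ two_pos, hS j (by omega),
        if_neg (by omega)]
      push_cast
      linear_combination hd j + (d (2 * j + 1) + d (2 * j + 2) * (j + 1) + d (2 * j + 1) * j) * h2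
    · rw [if_neg (by omega), if_neg (by omega)]
      push_cast
      linear_combination (d (2 * j + 3) * (j + 2) + d (2 * j + 2) * (j + 1)) * h2

/-- The Hankel determinants of a sequence over `ZMod 2` with `d 0 = 1` and
`d (2n + 2) = d (2n + 1) + d n` do not vanish. -/
theorem hankel_det_ne_zero {d : ℕ → ZMod 2} (h0 : d 0 = 1)
    (hd : ∀ n, d (2 * n + 2) = d (2 * n + 1) + d n) (n : ℕ) :
    (Matrix.of fun i j : Fin n => d (i.1 + j.1)).det ≠ 0 := by
  cases n with
  | zero => simp
  | succ m =>
  intro hdet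
  obtain ⟨v, hv0, hv⟩ := Matrix.exists_mulVec_eq_zero_iff.2 hdet
  set S : (ZMod 2)[X] := ∑ k ∈ Finset.range (2 * m + 2), C (d k) * X ^ k with hSdef
  set Q : (ZMod 2)[X] := ∑ j : Fin (m + 1), C (v j) * X ^ (m - j.1) with hQdef
  set P : (ZMod 2)[X] := ∑ k ∈ Finset.range m, C ((Q * S).coeff k) * X ^ k with hPdef
  have hS : ∀ k < 2 * m + 2, S.coeff k = d k := fun k hk => by
    simp [hSdef, finsetSum_coeff, coeff_C_mul, coeff_X_pow, hk]
  have hQ0 : Q ≠ 0 := by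
    intro hQ
    refine hv0 (funext fun i => ?_)
    have := congrArg (fun A => coeff A (m - i.1)) hQ
    simp only [hQdef, finsetSum_coeff, coeff_C_mul, coeff_X_pow, coeff_zero] at this
    rw [Finset.sum_eq_single i] at this
    · simpa using this
    · intro j _ hj
      rw [if_neg, mul_zero]
      intro h
      exact hj (Fin.ext (by omega))
    · simp
  have hQdeg : Q.natDegree ≤ m :=
    natDegree_sum_le_of_forall_le _ _ fun j _ =>
      (natDegree_C_mul_X_pow_le _ _).trans (Nat.sub_le _ _)
  have hPdeg : (X * P).natDegree ≤ m := by
    rw [hPdef, Finset.mul_sum]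
    refine natDegree_sum_le_of_forall_le _ _ fun k hk => ?_
    rw [Finset.mem_range] at hk
    rw [show X * (C ((Q * S).coeff k) * X ^ k) = C ((Q * S).coeff k) * X ^ (k + 1) by ring]
    exact (natDegree_C_mul_X_pow_le _ _).trans hk
  have hPdeg' : P.natDegree ≤ m := by
    by_cases hP : P = 0
    · simp [hP]
    · rw [natDegree_X_mul hP] at hPdeg
      omega
  obtain ⟨R, hR⟩ : X ^ (2 * m + 1) ∣ Q * S - P := by
    rw [X_pow_dvd_iff]
    intro k hk
    have hPc : P.coeff k = if k < m then (Q * S).coeff k else 0 := by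
      simp [hPdef, finsetSum_coeff, coeff_C_mul, coeff_X_pow]
    rw [coeff_sub, hPc]
    split_ifs with h
    · simp
    · have := congrFun hv ⟨k - m, by omega⟩
      rw [Pi.zero_apply] at this
      rw [sub_zero, hQdef, Finset.sum_mul, finsetSum_coeff, ← this]
      simp only [Matrix.mulVec, dotProduct, Matrix.of_apply]
      refine Finset.sum_congr rfl fun j _ => ?_
      rw [mul_assoc, coeff_C_mul, coeff_X_pow_mul', if_pos (by omega), hS _ (by omega), mul_comm]
      congr 2
      omega
  obtain ⟨T, hT⟩ := X_pow_dvd_riccati h0 hd _ hS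
  refine riccati_ne_of_ne_zero (P := P) hQ0 (sub_eq_zero.1 ?_)
  set E := Q * P + (X + X ^ 2) * derivative (Q * P) - (Q ^ 2 + X ^ 2 * P ^ 2) with hE
  have hdvd : X ^ (2 * m + 2) ∣ E := by
    have h2 : (2 : (ZMod 2)[X]) = 0 := CharTwo.two_eq_zero
    have hP : P = Q * S - X ^ (2 * m + 1) * R := by rw [← hR]; ring
    have hM : derivative (X ^ (2 * m + 1) : (ZMod 2)[X]) = X ^ (2 * m) := by
      rw [derivative_X_pow]
      simp [CharTwo.two_eq_zero]
    have hQP : derivative (Q * P) = Q ^ 2 * derivative S - X ^ (2 * m) * (Q * R) -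
        X ^ (2 * m + 1) * derivative (Q * R) := by
      rw [show Q * P = Q * Q * S - X ^ (2 * m + 1) * (Q * R) by rw [hP]; ring]
      simp only [derivative_mul, derivative_sub, hM]
      linear_combination Q * derivative Q * S * h2
    refine ⟨Q ^ 2 * T - Q * R - (X + 1) * derivative (Q * R) - X ^ (2 * m + 2) * R ^ 2, ?_⟩
    rw [hE, hQP, hP]
    linear_combination Q ^ 2 * hT +
      (X ^ 2 * Q * S * X ^ (2 * m + 1) * R - X ^ (2 * m + 1) * Q * R) * h2
  have hdeg : E.natDegree < 2 * m + 2 := by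
    have hQP : (Q * P).natDegree ≤ 2 * m := natDegree_mul_le.trans (by omega)
    have hD : (derivative (Q * P)).natDegree ≤ 2 * m - 1 :=
      (natDegree_derivative_le _).trans (by omega)
    have hX : (X + X ^ 2 : (ZMod 2)[X]).natDegree ≤ 2 := by compute_degree
    have h₁ : ((X + X ^ 2) * derivative (Q * P)).natDegree < 2 * m + 2 := by
      rcases Nat.eq_zero_or_pos m with rfl | hm
      · rw [derivative_of_natDegree_zero (by omega)]
        simp
      · exact natDegree_mul_le.trans_lt (by omega)
    have h₂ : (Q ^ 2).natDegree < 2 * m + 2 := natDegree_pow_le.trans_lt (by omega)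
    have h₃ : (X ^ 2 * P ^ 2).natDegree < 2 * m + 2 := by
      rw [← mul_pow]
      exact natDegree_pow_le.trans_lt (by omega)
    have h₄ := natDegree_add_le (Q * P) ((X + X ^ 2) * derivative (Q * P))
    have h₅ := natDegree_add_le (Q ^ 2) (X ^ 2 * P ^ 2)
    have h₆ := natDegree_sub_le (Q * P + (X + X ^ 2) * derivative (Q * P))
      (Q ^ 2 + X ^ 2 * P ^ 2)
    rw [← hE] at h₆
    omega
  by_contra hne
  have := natDegree_le_of_dvd hdvd hne
  rw [natDegree_X_pow] at this
  omega

/-- If `f = 1 - 2b`, then the Hankel determinants of `f` are powers of two times odd numbers as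
soon as the Hankel determinants modulo two of `b k + b (k + 2)` do not vanish. -/
theorem hankel_eq_two_pow_mul_odd {f b : ℕ → ℤ} (hfb : ∀ n, f n = 1 - 2 * b n) (m : ℕ)
    (hdet : (Matrix.of fun i j : Fin m =>
      ((b (i.1 + j.1) + b (i.1 + j.1 + 2) : ℤ) : ZMod 2)).det ≠ 0) :
    ∃ c, Odd c ∧ hankel f (m + 1) = 2 ^ m * c := by
  set A₁ : Matrix (Fin (m + 1)) (Fin (m + 1)) ℤ := Matrix.of fun i j =>
    Fin.cases (f j.1) (fun i' : Fin m => f (i'.1 + 1 + j.1) - f (i'.1 + j.1)) i with hA₁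
  set A₂ : Matrix (Fin (m + 1)) (Fin (m + 1)) ℤ := Matrix.of fun i j =>
    Fin.cases (A₁ i 0) (fun j' : Fin m => A₁ i j'.succ - A₁ i j'.castSucc) j with hA₂
  set A₃ : Matrix (Fin (m + 1)) (Fin (m + 1)) ℤ := Matrix.of fun i j =>
    Fin.cases (A₂ 0 j) (fun i' : Fin m => Fin.cases (b i'.1 - b (i'.1 + 1))
      (fun j' : Fin m => 2 * b (i'.1 + j'.1 + 1) - b (i'.1 + j'.1) - b (i'.1 + j'.1 + 2)) j) i
    with hA₃
  have h₁ : hankel f (m + 1) = A₁.det :=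
    Matrix.det_eq_of_forall_row_eq_smul_add_pred (fun _ => 1) (fun j => by simp [hA₁])
      fun i j => by simp [hA₁]
  have h₂ : A₁.det = A₂.det :=
    Matrix.det_eq_of_forall_col_eq_smul_add_pred (fun _ => 1) (fun j => by simp [hA₂])
      fun i j => by simp [hA₂]
  have h₃ : A₂.det = 2 ^ m * A₃.det := by
    have := Matrix.det_mul_column (Fin.cons 1 fun _ => 2 : Fin (m + 1) → ℤ) A₃
    rw [Fin.prod_univ_succ] at this
    simp only [Fin.cons_zero, Fin.cons_succ, Finset.prod_const, Finset.card_univ,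
      Fintype.card_fin, one_mul] at this
    rw [← this]
    congr 1
    ext i j
    refine Fin.cases ?_ (fun i => ?_) i
    · simp [hA₃]
    · refine Fin.cases ?_ (fun j => ?_) j
      · simp [hA₃, hA₂, hA₁, hfb]
        ring
      · simp [hA₃, hA₂, hA₁, hfb]
        ring_nf
  refine ⟨A₃.det, ?_, by rw [h₁, h₂, h₃]⟩
  have h2 : (2 : ZMod 2) = 0 := rfl
  rw [← Int.not_even_iff_odd, even_iff_two_dvd]
  refine mt (ZMod.intCast_zmod_eq_zero_iff_dvd _ 2).2 ?_
  rw [Int.cast_det, Matrix.det_succ_row_zero, Fin.sum_univ_succ, Finset.sum_eq_zero, add_zero]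
  · have h00 : A₃.map (fun x => (x : ZMod 2)) 0 0 = 1 := by simp [hA₃, hA₂, hA₁, hfb, h2]
    have hsub : (A₃.map fun x => (x : ZMod 2)).submatrix Fin.succ (Fin.succAbove 0) =
        Matrix.of fun i j : Fin m => ((b (i.1 + j.1) + b (i.1 + j.1 + 2) : ℤ) : ZMod 2) := by
      ext i j
      simp [hA₃, h2, CharTwo.sub_eq_add]
    simpa only [Fin.val_zero, pow_zero, one_mul, h00, hsub] using hdet
  · intro j _
    simp [hA₃, hA₂, hA₁, hfb, h2]

end Hankel

/-- The recurrence modulo two satisfied by `b k + b (k + 2)`, where `b n` is the parity of the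
number of nonzero ternary digits of `n`. -/
theorem ternary_parity_recurrence {b : ℕ → ℤ} (hb0 : ∀ n, b (3 * n) = b n)
    (hb1 : ∀ n, b (3 * n + 1) = 1 - b n) (hb2 : ∀ n, b (3 * n + 2) = 1 - b n) (n : ℕ) :
    (b n + b (n + 2) + b (2 * n + 1) + b (2 * n + 2) + b (2 * n + 3) + b (2 * n + 4)) % 2 = 0 := by
  have consecutive : ∀ m, (b m + b (m + 1) + b (2 * m + 1) + b (2 * m + 2)) % 2 = 1 := by
    intro m
    induction m using Nat.strong_induction_on with
    | _ m ih =>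
    obtain ⟨k, rfl | rfl | rfl⟩ : ∃ k, m = 3 * k ∨ m = 3 * k + 1 ∨ m = 3 * k + 2 :=
      ⟨m / 3, by omega⟩
    · rw [show 2 * (3 * k) = 3 * (2 * k) by ring, hb0, hb1, hb1, hb2]
      omega
    · rw [show 2 * (3 * k + 1) + 1 = 3 * (2 * k + 1) by ring,
        show 2 * (3 * k + 1) + 2 = 3 * (2 * k + 1) + 1 by ring, hb0, hb1, hb1, hb2]
      omega
    · rw [show 2 * (3 * k + 2) + 1 = 3 * (2 * k + 1) + 2 by ring,
        show 2 * (3 * k + 2) + 2 = 3 * (2 * k + 2) by ring,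
        show 3 * k + 2 + 1 = 3 * (k + 1) by ring, hb0, hb0, hb2, hb2]
      have := ih k (by omega)
      omega
  obtain ⟨k, rfl | rfl | rfl⟩ : ∃ k, n = 3 * k ∨ n = 3 * k + 1 ∨ n = 3 * k + 2 :=
    ⟨n / 3, by omega⟩
  · rw [show 2 * (3 * k) + 3 = 3 * (2 * k + 1) by ring,
      show 2 * (3 * k) + 4 = 3 * (2 * k + 1) + 1 by ring,
      show 2 * (3 * k) = 3 * (2 * k) by ring, hb0, hb0, hb1, hb1, hb2, hb2]
    omega
  · rw [show 2 * (3 * k + 1) + 1 = 3 * (2 * k + 1) by ring,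
      show 2 * (3 * k + 1) + 2 = 3 * (2 * k + 1) + 1 by ring,
      show 2 * (3 * k + 1) + 3 = 3 * (2 * k + 1) + 2 by ring,
      show 2 * (3 * k + 1) + 4 = 3 * (2 * k + 2) by ring,
      show 3 * k + 1 + 2 = 3 * (k + 1) by ring, hb0, hb0, hb0, hb1, hb1, hb2]
    have := consecutive k
    omega
  · rw [show 2 * (3 * k + 2) + 1 = 3 * (2 * k + 1) + 2 by ring,
      show 2 * (3 * k + 2) + 2 = 3 * (2 * k + 2) by ring,
      show 2 * (3 * k + 2) + 3 = 3 * (2 * k + 2) + 1 by ring,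
      show 2 * (3 * k + 2) + 4 = 3 * (2 * k + 2) + 2 by ring,
      show 3 * k + 2 + 2 = 3 * (k + 1) + 1 by ring, hb0, hb1, hb1, hb2, hb2, hb2]
    have := consecutive k
    omega

/-- The sequence `f` associated with `v = ![1, -1, -1]` (d = 3) is Apwenian. -/
theorem F3_apwenian (f : ℕ → ℤ)
    (h0 : f 0 = 1)
    (hf : ∀ n : ℕ, ∀ i : Fin 3, f (3 * n + (i : ℕ)) = ![1, -1, -1] i * f n) :
    ∀ n : ℕ, 0 < n →
      (2 : ℤ) ^ (n - 1) ∣ hankel f n ∧ Odd (hankel f n / 2 ^ (n - 1)) := by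
  have hf0 : ∀ n, f (3 * n) = f n := fun n => by simpa using hf n 0
  have hf1 : ∀ n, f (3 * n + 1) = -f n := fun n => by simpa using hf n 1
  have hf2 : ∀ n, f (3 * n + 2) = -f n := fun n => by simpa using hf n 2
  have hodd : ∀ n, f n % 2 = 1 := by
    intro n
    induction n using Nat.strong_induction_on with
    | _ n ih =>
    rcases Nat.eq_zero_or_pos n with rfl | hn
    · omega
    have := ih (n / 3) (by omega)
    obtain h | h | h : n = 3 * (n / 3) ∨ n = 3 * (n / 3) + 1 ∨ n = 3 * (n / 3) + 2 := by omega
    · rw [h, hf0]; omega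
    · rw [h, hf1]; omega
    · rw [h, hf2]; omega
  set b : ℕ → ℤ := fun n => (1 - f n) / 2 with hb
  have hfb : ∀ n, f n = 1 - 2 * b n := fun n => by have := hodd n; simp only [hb]; omega
  have hb0 : ∀ n, b (3 * n) = b n := fun n => by have := hf0 n; simp only [hfb] at this; omega
  have hb1 : ∀ n, b (3 * n + 1) = 1 - b n := fun n => by
    have := hf1 n; simp only [hfb] at this; omega
  have hb2 : ∀ n, b (3 * n + 2) = 1 - b n := fun n => by
    have := hf2 n; simp only [hfb] at this; omega
  have hd : ∀ n, ((b (2 * n + 2) + b (2 * n + 2 + 2) : ℤ) : ZMod 2) =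
      ((b (2 * n + 1) + b (2 * n + 1 + 2) : ℤ) : ZMod 2) + ((b n + b (n + 2) : ℤ) : ZMod 2) := by
    intro n
    rw [← Int.cast_add, ZMod.intCast_eq_intCast_iff]
    have := ternary_parity_recurrence hb0 hb1 hb2 n
    change _ % 2 = _ % 2
    simp only [add_assoc, Nat.reduceAdd] at *
    omega
  intro n hn
  obtain ⟨m, rfl⟩ := Nat.exists_eq_succ_of_ne_zero hn.ne'
  obtain ⟨c, hc, h⟩ := hankel_eq_two_pow_mul_odd hfb m
    (hankel_det_ne_zero (d := fun k => ((b k + b (k + 2) : ℤ) : ZMod 2)) (by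
      have h : b 0 = 0 := by have := hfb 0; omega
      have h' := hb2 0
      simp only [mul_zero, zero_add] at h'
      simp [h, h']) hd m)
  rw [Nat.succ_eq_add_one, h, Nat.add_sub_cancel, Int.mul_ediv_cancel_left _ (by positivity)]
  exact ⟨dvd_mul_right _ _, hc⟩
end

section
/- The sequence f defined from v = (1,−1,−1,−1,1) with d = 5 is Apwenian: for every positive integer n, 2^(n−1) divides the Hankel determinant H_n(f) and H_n(f)/2^(n−1) is an odd integer. -/
section

open PowerSeries

theorem powerSeries_zmod_two_two_eq_zero : (2 : (ZMod 2)⟦X⟧) = 0 := by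
  have h : (2 : ZMod 2) = 0 := rfl
  rw [← map_ofNat (C (R := ZMod 2)) 2, h, map_zero]

theorem coeff_sq_zmod_two (E : (ZMod 2)⟦X⟧) (n : ℕ) :
    coeff n (E ^ 2) = if 2 ∣ n then coeff (n / 2) E else 0 := by
  have h : (E.expand 2 two_ne_zero).map (frobenius (ZMod 2) 2) = E ^ 2 :=
    MvPowerSeries.map_frobenius_expand 2 two_ne_zero
  rw [← h, ZMod.frobenius_zmod, map_id, id, coeff_expand]

/-- Over `ZMod 2` this equation says that `E` has constant coefficient `1` and that its
coefficients satisfy `e n = e (2 * n + 1) + e (2 * n + 2)`. -/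
def Riccati (E : (ZMod 2)⟦X⟧) : Prop :=
  E + (X + X ^ 2) * derivative (ZMod 2) E = 1 + X ^ 2 * E ^ 2

namespace Riccati

theorem of_coeff {E : (ZMod 2)⟦X⟧} (h0 : coeff 0 E = 1)
    (h : ∀ n, coeff n E = coeff (2 * n + 1) E + coeff (2 * n + 2) E) : Riccati E := by
  have h2 : (2 : ZMod 2) = 0 := rfl
  unfold Riccati
  ext n
  rw [add_mul, pow_two X, mul_assoc, mul_assoc]
  match n with
  | 0 => simpa using h0
  | 1 =>
    have e (F : (ZMod 2)⟦X⟧) : coeff 1 (X * F) = coeff 0 F := coeff_succ_X_mul 0 F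
    simp only [map_add, e, coeff_derivative, coeff_one, coeff_zero_X_mul]
    simp [CharTwo.add_self_eq_zero]
  | n + 2 =>
    simp only [map_add, coeff_derivative, coeff_one, coeff_succ_X_mul,
      coeff_sq_zmod_two]
    obtain ⟨m, rfl | rfl⟩ := n.even_or_odd'
    · simp
      linear_combination (coeff (2 * m + 2) E * (m + 1) + coeff (2 * m + 1) E * m) * h2 - h m
    · rw [if_neg (show ¬ 2 ∣ 2 * m + 1 by omega)]
      simp
      linear_combination
        (coeff (2 * m + 3) E * (m + 2) + coeff (2 * m + 2) E * (m + 1)) * h2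

theorem constantCoeff_eq_one {E : (ZMod 2)⟦X⟧} (h : Riccati E) : constantCoeff E = 1 := by
  simpa using congrArg constantCoeff h

/-- One step of the J-fraction expansion of a solution: the tail is again a solution. -/
theorem exists_continued_fraction_step {E : (ZMod 2)⟦X⟧} (h : Riccati E) :
    ∃ (b : ZMod 2) (G : (ZMod 2)⟦X⟧), Riccati G ∧ E * (1 + C b * X + X ^ 2 * G) = 1 := by
  have hE := h.constantCoeff_eq_one
  have hinv : E * E⁻¹ = 1 := PowerSeries.mul_inv_cancel E (by simp [hE])
  obtain ⟨F, hF⟩ : X ∣ E⁻¹ - 1 := by simp [X_dvd_iff, hE]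
  obtain ⟨G, hG⟩ : X ∣ F - C (constantCoeff F) := by simp [X_dvd_iff]
  have hD : E⁻¹ = 1 + C (constantCoeff F) * X + X ^ 2 * G := by
    linear_combination hF + X * hG
  rw [hD] at hinv
  refine ⟨constantCoeff F, G, ?_, hinv⟩
  generalize constantCoeff F = b at hinv
  have hb : C b * C b = (C b : (ZMod 2)⟦X⟧) := by
    rw [← map_mul]
    congr 1
    exact (by decide : ∀ x : ZMod 2, x * x = x) b
  have h2 := powerSeries_zmod_two_two_eq_zero
  have hD' : derivative (ZMod 2) (1 + C b * X + X ^ 2 * G) =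
      C b + X ^ 2 * derivative (ZMod 2) G := by
    simp only [map_add, Derivation.leibniz, Derivation.leibniz_pow, derivative_C, derivative_X,
      derivative_one, smul_eq_mul, nsmul_eq_mul]
    push_cast
    linear_combination (G * X) * h2
  have hd := congrArg (derivative (ZMod 2)) hinv
  rw [Derivation.leibniz, hD', derivative_one, smul_eq_mul, smul_eq_mul] at hd
  unfold Riccati at h ⊢
  apply mul_left_cancel₀ (pow_ne_zero 2 X_ne_zero : (X : (ZMod 2)⟦X⟧) ^ 2 ≠ 0)
  generalize derivative (ZMod 2) E = E' at *
  generalize derivative (ZMod 2) G = G' at *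
  generalize (C b : (ZMod 2)⟦X⟧) = c at *
  have key : ∀ D, E * D = 1 → E * (c + X ^ 2 * G') + D * E' = 0 →
      D - (X + X ^ 2) * (c + X ^ 2 * G') = D ^ 2 + X ^ 2 := by
    intro D hinv hd
    linear_combination D ^ 2 * h +
      (-D + (X + X ^ 2) * (c + X ^ 2 * G') + X ^ 2 * (E * D + 1)) * hinv -
      (X + X ^ 2) * D * hd
  linear_combination key _ hinv hd + X ^ 2 * hb +
    (c * X ^ 2 + c * X + X ^ 2 * G + c * X ^ 3 * G + X ^ 2 * (X + X ^ 2) * G') * h2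

end Riccati

theorem det_hankel_succ_of_mul_eq_one {E G : (ZMod 2)⟦X⟧} {b : ZMod 2}
    (h : E * (1 + C b * X + X ^ 2 * G) = 1) (n : ℕ) :
    (Matrix.of fun i j : Fin (n + 1) => coeff (i.1 + j.1) E).det =
      (Matrix.of fun i j : Fin n => coeff (i.1 + j.1) G).det := by
  set D := 1 + C b * X + X ^ 2 * G with hD
  have hD0 : coeff 0 D = 1 := by simp [hD]
  have hE0 : coeff 0 E = 1 := by
    simpa [hD] using congrArg constantCoeff h
  have hDG : ∀ k, coeff (k + 2) D = coeff k G := by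
    intro k
    have e : (X : (ZMod 2)⟦X⟧) ^ 2 = X * X := pow_two X
    rw [hD, e, mul_comm (C b), mul_assoc]
    simp only [map_add, coeff_one, coeff_succ_X_mul, coeff_C]
    simp
  have hconv : ∀ m, 0 < m → ∑ l ∈ Finset.range (m + 1), coeff l E * coeff (m - l) D = 0 := by
    intro m hm
    have := congrArg (coeff m) h
    rwa [coeff_mul, Finset.Nat.sum_antidiagonal_eq_sum_range_succ
      (fun i j => coeff i E * coeff j D), coeff_one, if_neg hm.ne'] at this
  let N : ℕ → ℕ → ZMod 2 := fun k j =>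
    if k = 0 then if j = 0 then 1 else 0 else if j = 0 then 0 else coeff (k + j) D
  let U : Matrix (Fin (n + 1)) (Fin (n + 1)) (ZMod 2) :=
    .of fun l j => if l.1 ≤ j.1 then coeff (j.1 - l.1) D else 0
  let T : Matrix (Fin (n + 1)) (Fin (n + 1)) (ZMod 2) :=
    .of fun i l => if l.1 ≤ i.1 then coeff (i.1 - l.1) E else 0
  have hU : U.det = 1 := by
    rw [Matrix.det_of_isUpperTriangular]
    · simp [U, hD0]
    · intro i j hij
      have : j.1 < i.1 := hij
      simp [U, this.not_ge, -Fin.val_fin_le]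
  have hT : T.det = 1 := by
    rw [Matrix.det_of_isLowerTriangular]
    · simp [T, hE0]
    · intro i j hij
      have : i.1 < j.1 := hij
      simp [T, this.not_ge, -Fin.val_fin_le]
  have hN : (Matrix.of fun i j : Fin (n + 1) => N i j).det =
      (Matrix.of fun i j : Fin n => coeff (i.1 + j.1) G).det := by
    rw [Matrix.det_succ_row_zero, Fin.sum_univ_succ]
    simp only [N, Matrix.of_apply]
    simp
    congr 1
    ext i j
    simp [← hDG]
    congr 2
    ring
  have hrange : ∀ (g : ℕ → ZMod 2) (i : ℕ), i < n + 1 →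
      ∑ l : Fin (n + 1), (if l.1 ≤ i then g l else 0) = ∑ l ∈ Finset.range (i + 1), g l := by
    intro g i hi
    rw [Fin.sum_univ_eq_sum_range (fun l => if l ≤ i then g l else 0), ← Finset.sum_filter]
    congr 1
    ext l
    simp
    omega
  have hmul : (Matrix.of fun i j : Fin (n + 1) => coeff (i.1 + j.1) E) * U =
      T * Matrix.of fun i j : Fin (n + 1) => N i j := by
    ext ⟨i, hi⟩ ⟨j, hj⟩
    simp only [Matrix.mul_apply, Matrix.of_apply, U, T, mul_ite, ite_mul, mul_zero, zero_mul]
    rw [hrange (fun l => coeff (i + l) E * coeff (j - l) D) j hj,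
      hrange (fun l => coeff (i - l) E * N l j) i hi]
    rcases j with _ | j
    · rw [Finset.sum_range_succ' _ i]
      simp [N, hD0]
    · have hs := hconv (i + (j + 1)) (by omega)
      rw [add_assoc, Finset.sum_range_add] at hs
      rw [CharTwo.add_eq_zero, ← Finset.sum_range_reflect] at hs
      rw [Finset.sum_range_succ' _ i]
      simp only [N, Nat.add_eq_zero_iff, one_ne_zero, and_false, if_false, if_true, mul_zero,
        add_zero]
      calc _ = _ := Finset.sum_congr rfl fun l _ => by
            rw [show i + (j + 1) - (i + l) = j + 1 - l by omega]
        _ = _ := hs.symm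
        _ = _ := Finset.sum_congr rfl fun l hl => by
            have := Finset.mem_range.1 hl
            rw [show i - 1 - l = i - (l + 1) by omega,
              show i + (j + 1) - (i - (l + 1)) = l + 1 + (j + 1) by omega]
  have := congrArg Matrix.det hmul
  rwa [Matrix.det_mul, Matrix.det_mul, hU, hT, hN, mul_one, one_mul] at this

theorem Riccati.det_hankel_eq_one (n : ℕ) : ∀ {E : (ZMod 2)⟦X⟧}, Riccati E →
    (Matrix.of fun i j : Fin n => coeff (i.1 + j.1) E).det = 1 := by
  induction n with
  | zero => intro E _; simp
  | succ n ih =>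
    intro E hE
    obtain ⟨b, G, hG, h⟩ := hE.exists_continued_fraction_step
    rw [det_hankel_succ_of_mul_eq_one h, ih hG]

theorem exists_hankel_eq_two_pow_mul {f b : ℕ → ℤ} (h : ∀ k, f k = 1 - 2 * b k) (n : ℕ) :
    ∃ M : ℤ, hankel f (n + 1) = 2 ^ n * M ∧ (M : ZMod 2) =
      (Matrix.of fun i j : Fin n => (b (i.1 + j.1) + b (i.1 + j.1 + 2) : ZMod 2)).det := by
  let B : Matrix (Fin (n + 1)) (Fin (n + 1)) ℤ :=
    .of fun i j => Fin.cases (f j) (fun i : Fin n => b (i + j) - b (i + j + 1)) i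
  let w : Fin (n + 1) → ℤ := Fin.cons 1 fun _ => 2
  refine ⟨B.det, ?_, ?_⟩
  · have hw : (Matrix.diagonal w).det = 2 ^ n := by
      simp [Matrix.det_diagonal, Fin.prod_univ_succ, w]
    rw [← hw, ← Matrix.det_mul, hankel]
    refine Matrix.det_eq_of_forall_row_eq_smul_add_pred (fun _ => 1) ?_ ?_
    · intro j
      simp [w, B]
    · intro i j
      simp [w, B, h, show i.1 + 1 + j.1 = i.1 + j.1 + 1 by ring]
      ring
  · let Q : Matrix (Fin (n + 1)) (Fin (n + 1)) (ZMod 2) :=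
      .of fun i j => Fin.cases (Fin.cases 1 (fun _ => 0) j)
        (fun i : Fin n => Fin.cases (b i + b (i + 1) : ZMod 2)
          (fun j : Fin n => (b (i + j) + b (i + j + 2) : ZMod 2)) j) i
    have h2 : (2 : ZMod 2) = 0 := rfl
    have hQ : (B.map (Int.cast : ℤ → ZMod 2)).det = Q.det := by
      refine Matrix.det_eq_of_forall_col_eq_smul_add_pred (fun _ => 1) ?_ ?_
      · intro i
        refine Fin.cases ?_ (fun i => ?_) i
        · simp [B, Q, h, h2]
        · simp [B, Q, CharTwo.sub_eq_add]
      · intro i j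
        refine Fin.cases ?_ (fun i => ?_) i
        · simp [B, Q, h, h2]
        · simp [B, Q, ← add_assoc]
          linear_combination (b (i + j + 1) - b (i + j) - b (i + j + 2) : ZMod 2) * h2
    rw [Int.cast_det, hQ, Matrix.det_succ_row_zero, Fin.sum_univ_succ]
    simp [Q]
    rfl

theorem add_succ_add_double_eq_one {a : ℕ → ZMod 2}
    (ha : ∀ n, a (5 * n) = a n ∧ a (5 * n + 1) = a n + 1 ∧ a (5 * n + 2) = a n + 1 ∧
      a (5 * n + 3) = a n + 1 ∧ a (5 * n + 4) = a n) (n : ℕ) :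
    a n + a (n + 1) + a (2 * n + 1) + a (2 * n + 2) = 1 := by
  induction n using Nat.strong_induction_on with
  | _ n ih =>
    have h2 : (2 : ZMod 2) = 0 := rfl
    obtain ⟨q, hq⟩ : ∃ q, q = n / 5 := ⟨_, rfl⟩
    have h0 := ha q
    have h1 := ha (q + 1)
    have h3 := ha (2 * q)
    have h4 := ha (2 * q + 1)
    have h5 := ha (2 * q + 2)
    have hcase : n = 5 * q ∨ n = 5 * q + 1 ∨ n = 5 * q + 2 ∨ n = 5 * q + 3 ∨ n = 5 * q + 4 := by
      omega
    ring_nf at h0 h1 h3 h4 h5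
    rcases hcase with h | h | h | h | h
    all_goals
      have hprev := ih q
      clear ih hq
      subst h
      ring_nf at hprev ⊢
      simp only [h0, h1, h3, h4, h5]
    · linear_combination (a q + a (q * 2) + 1) * h2
    · linear_combination (a q + a (q * 2) + 1) * h2
    · linear_combination (a q + a (1 + q * 2) + 1) * h2
    · linear_combination (a q + a (1 + q * 2) + 1) * h2
    · exact hprev (by omega)

theorem add_add_two_eq_add_double {a : ℕ → ZMod 2}
    (ha : ∀ n, a (5 * n) = a n ∧ a (5 * n + 1) = a n + 1 ∧ a (5 * n + 2) = a n + 1 ∧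
      a (5 * n + 3) = a n + 1 ∧ a (5 * n + 4) = a n) (n : ℕ) :
    a n + a (n + 2) = (a (2 * n + 1) + a (2 * n + 3)) + (a (2 * n + 2) + a (2 * n + 4)) := by
  have h2 : (2 : ZMod 2) = 0 := rfl
  obtain ⟨q, hq⟩ : ∃ q, q = n / 5 := ⟨_, rfl⟩
  have hrel := add_succ_add_double_eq_one ha q
  have h0 := ha q
  have h1 := ha (q + 1)
  have h3 := ha (2 * q)
  have h4 := ha (2 * q + 1)
  have h5 := ha (2 * q + 2)
  have hcase : n = 5 * q ∨ n = 5 * q + 1 ∨ n = 5 * q + 2 ∨ n = 5 * q + 3 ∨ n = 5 * q + 4 := by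
    omega
  ring_nf at h0 h1 h3 h4 h5 hrel
  rcases hcase with h | h | h | h | h
  all_goals
    clear hq
    subst h
    ring_nf
    simp only [h0, h1, h3, h4, h5]
  · linear_combination (a q - 2 * a (q * 2) - 1) * h2
  · linear_combination (a q - a (q * 2) - a (1 + q * 2)) * h2
  · linear_combination (a q - 2 * a (1 + q * 2) - 1) * h2
  · linear_combination hrel - (2 * a (1 + q * 2) + a (2 + q * 2)) * h2
  · linear_combination hrel - (a (1 + q * 2) + 2 * a (2 + q * 2)) * h2

end

/-- The sequence `f` associated with `v = ![1, -1, -1, -1, 1]` (d = 5) is Apwenian. -/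
theorem F5_apwenian (f : ℕ → ℤ)
    (h0 : f 0 = 1)
    (hf : ∀ n : ℕ, ∀ i : Fin 5, f (5 * n + (i : ℕ)) = ![1, -1, -1, -1, 1] i * f n) :
    ∀ n : ℕ, 0 < n →
      (2 : ℤ) ^ (n - 1) ∣ hankel f n ∧ Odd (hankel f n / 2 ^ (n - 1)) := by
  have hrec : ∀ n, f (5 * n) = f n ∧ f (5 * n + 1) = -f n ∧ f (5 * n + 2) = -f n ∧
      f (5 * n + 3) = -f n ∧ f (5 * n + 4) = f n := fun n =>
    ⟨by simpa using hf n 0, by simpa using hf n 1, by simpa using hf n 2, by simpa using hf n 3,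
      by simpa using hf n 4⟩
  have hodd : ∀ k, ∃ b, f k = 1 - 2 * b := by
    intro k
    induction k using Nat.strong_induction_on with
    | _ k ih =>
      rcases Nat.eq_zero_or_pos k with rfl | hk
      · exact ⟨0, by simp [h0]⟩
      · obtain ⟨b, hb⟩ := ih (k / 5) (by omega)
        have h := hrec (k / 5)
        have hcase : k = 5 * (k / 5) ∨ k = 5 * (k / 5) + 1 ∨ k = 5 * (k / 5) + 2 ∨
          k = 5 * (k / 5) + 3 ∨ k = 5 * (k / 5) + 4 := by omega
        have : f k = f (k / 5) ∨ f k = -f (k / 5) := by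
          generalize k / 5 = q at h hcase
          rcases hcase with rfl | rfl | rfl | rfl | rfl
          exacts [.inl h.1, .inr h.2.1, .inr h.2.2.1, .inr h.2.2.2.1, .inl h.2.2.2.2]
        rcases this with h | h
        · exact ⟨b, by omega⟩
        · exact ⟨1 - b, by omega⟩
  choose b hb using hodd
  have hsame : ∀ {m n}, f m = f n → (b m : ZMod 2) = b n := by
    intro m n h
    rw [show b m = b n by linarith [hb m, hb n]]
  have hneg : ∀ {m n}, f m = -f n → (b m : ZMod 2) = b n + 1 := by
    intro m n h
    rw [show b m = 1 - b n by linarith [hb m, hb n]]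
    push_cast
    rw [CharTwo.sub_eq_add, add_comm]
  have hrel := add_add_two_eq_add_double (a := fun k => (b k : ZMod 2)) fun n =>
    ⟨hsame (hrec n).1, hneg (hrec n).2.1, hneg (hrec n).2.2.1, hneg (hrec n).2.2.2.1,
      hsame (hrec n).2.2.2.2⟩
  intro n hn
  obtain ⟨n, rfl⟩ := Nat.exists_eq_add_of_lt hn
  rw [zero_add, Nat.add_sub_cancel]
  obtain ⟨M, hM, hdet⟩ := exists_hankel_eq_two_pow_mul hb n
  have hRic : Riccati (PowerSeries.mk fun k => (b k + b (k + 2) : ZMod 2)) := by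
    refine Riccati.of_coeff ?_ ?_
    · have := hneg (hrec 0).2.2.1
      simp at this ⊢
      rw [this, ← add_assoc, CharTwo.add_self_eq_zero, zero_add]
    · intro k
      simpa using hrel k
  have hdet1 := hRic.det_hankel_eq_one n
  simp only [PowerSeries.coeff_mk] at hdet1
  rw [hdet1] at hdet
  rw [hM]
  refine ⟨Dvd.intro _ rfl, ?_⟩
  rw [Int.mul_ediv_cancel_left _ (by positivity)]
  exact (ZMod.intCast_eq_one_iff_odd).1 hdet
end

section
/- The sequence f defined from v = (1,−1,−1,1,−1,−1,−1,−1,−1,1,−1,−1,1) with d = 13 is Apwenian: for every positive integer n, 2^(n−1) divides the Hankel determinant H_n(f) and H_n(f)/2^(n−1) is an odd integer. -/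
open Polynomial in
/-- The linear functional on `𝔽₂[X]` whose `k`-th moment is `d k`. -/
noncomputable def momentFunctional (d : ℕ → ZMod 2) : (ZMod 2)[X] →ₗ[ZMod 2] ZMod 2 :=
  (Polynomial.basisMonomials (ZMod 2)).constr (ZMod 2) d

open Polynomial in
/-- The orthogonal polynomials of `momentFunctional d` (shifted by one, starting from `0`),
defined by their three-term recurrence. -/
noncomputable def orthogonalPoly (d : ℕ → ZMod 2) : ℕ → (ZMod 2)[X]
  | 0 => 0
  | 1 => 1
  | k + 2 => (X + C (momentFunctional d (X * orthogonalPoly d (k + 1) ^ 2))) *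
      orthogonalPoly d (k + 1) + orthogonalPoly d k

section Moments

open Polynomial

variable (d : ℕ → ZMod 2)

lemma momentFunctional_X_pow (k : ℕ) : momentFunctional d (X ^ k) = d k := by
  have h := (Polynomial.basisMonomials (ZMod 2)).constr_basis (ZMod 2) d k
  simpa [momentFunctional, monomial_one_right_eq_X_pow] using h

lemma momentFunctional_C_mul (a : ZMod 2) (p : (ZMod 2)[X]) :
    momentFunctional d (C a * p) = a * momentFunctional d p := by
  rw [← Polynomial.smul_eq_C_mul, map_smul, smul_eq_mul]

lemma momentFunctional_one : momentFunctional d 1 = d 0 := by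
  simpa using momentFunctional_X_pow d 0

/-- Squaring is additive over `𝔽₂`, so the recurrence on moments extends to all polynomials. -/
lemma momentFunctional_mul_sq (hd : ∀ n, d n = d (2 * n + 1) + d (2 * n + 2)) (p : (ZMod 2)[X]) :
    momentFunctional d (X * p ^ 2) + momentFunctional d (X ^ 2 * p ^ 2) =
      momentFunctional d p := by
  induction p using Polynomial.induction_on' with
  | add p q hp hq =>
    rw [CharTwo.add_sq, mul_add, mul_add, map_add, map_add, map_add, ← hp, ← hq]
    ring
  | monomial n a =>
    have ha : a ^ 2 = a := ZMod.pow_card a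
    have h1 : X * (C a * X ^ n) ^ 2 = C a * X ^ (2 * n + 1) := by
      rw [mul_pow, ← C_pow, ha]; ring
    have h2 : X ^ 2 * (C a * X ^ n) ^ 2 = C a * X ^ (2 * n + 2) := by
      rw [mul_pow, ← C_pow, ha]; ring
    rw [← C_mul_X_pow_eq_monomial, h1, h2]
    simp only [momentFunctional_C_mul, momentFunctional_X_pow]
    rw [hd n]; ring

lemma natDegree_orthogonalPoly_succ_le (k : ℕ) : (orthogonalPoly d (k + 1)).natDegree ≤ k := by
  induction k using Nat.twoStepInduction with
  | zero => simp [orthogonalPoly]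
  | one =>
    simp only [orthogonalPoly]
    compute_degree
  | more k ih1 ih2 =>
    rw [orthogonalPoly]
    refine (natDegree_add_le _ _).trans (max_le (natDegree_mul_le.trans ?_) (by omega))
    have := natDegree_X_add_C (momentFunctional d (X * orthogonalPoly d (k + 1 + 1) ^ 2))
    omega

/-- Polynomials satisfying the three-term recurrence are orthonormal for a functional
on `𝔽₂[X]` compatible with squaring. -/
lemma orthonormal_of_recurrence (L : (ZMod 2)[X] →ₗ[ZMod 2] ZMod 2) (Q : ℕ → (ZMod 2)[X])
    (h1 : L 1 = 1) (hsq : ∀ p, L (X * p ^ 2) + L (X ^ 2 * p ^ 2) = L p)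
    (hQ0 : Q 0 = 0) (hQ1 : Q 1 = 1)
    (hrec : ∀ k, Q (k + 2) = (X + C (L (X * Q (k + 1) ^ 2))) * Q (k + 1) + Q k) (k : ℕ) :
    ∀ j ≤ k, L (Q (k + 1) * Q (j + 1)) = if j = k then 1 else 0 := by
  have hC (a : ZMod 2) (p : (ZMod 2)[X]) : L (C a * p) = a * L p := by
    rw [← Polynomial.smul_eq_C_mul, map_smul, smul_eq_mul]
  have hLQ (k : ℕ) (p : (ZMod 2)[X]) : L (Q (k + 2) * p) =
      L (X * Q (k + 1) * p) + L (X * Q (k + 1) ^ 2) * L (Q (k + 1) * p) + L (Q k * p) := by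
    rw [hrec, ← hC, ← map_add, ← map_add]
    congr 1; ring
  have hXQ (k : ℕ) (p : (ZMod 2)[X]) : L (X * Q (k + 1) * p) =
      L (Q (k + 2) * p) + L (X * Q (k + 1) ^ 2) * L (Q (k + 1) * p) + L (Q k * p) := by
    rw [hLQ]
    linear_combination -(CharTwo.add_self_eq_zero (L (X * Q (k + 1) ^ 2) * L (Q (k + 1) * p)))
      - CharTwo.add_self_eq_zero (L (Q k * p))
  induction k using Nat.strong_induction_on with
  | _ k ih =>
  match k with
  | 0 =>
    intro j hj
    obtain rfl : j = 0 := by omega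
    simp [hQ1, h1]
  | k + 1 =>
    have orth (i j : ℕ) (hi : i ≤ k) (hj : j ≤ k) :
        L (Q (i + 1) * Q (j + 1)) = if i = j then 1 else 0 := by
      rcases le_total j i with h | h
      · rw [ih i (by omega) j h]; simp only [eq_comm]
      · rw [mul_comm, ih j (by omega) i h]
    -- orthogonality also for the zero polynomial `Q 0`
    have orth' (i j : ℕ) (hi : i ≤ k) (hj : j ≤ k + 1) :
        L (Q (i + 1) * Q j) = if i + 1 = j then 1 else 0 := by
      match j with
      | 0 => simp [hQ0]
      | j + 1 => rw [orth i j hi (by omega)]; simp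
    have lower (j : ℕ) (hj : j ≤ k) : L (Q (k + 2) * Q (j + 1)) = 0 := by
      rw [hLQ, orth k j le_rfl hj]
      rcases hj.eq_or_lt with rfl | hj
      · have h1 : L (Q j * Q (j + 1)) = 0 := by
          rw [mul_comm, orth' j j le_rfl (by omega)]; simp
        have h2 : X * Q (j + 1) * Q (j + 1) = X * Q (j + 1) ^ 2 := by ring
        rw [h1, h2, if_pos rfl, mul_one, add_zero, CharTwo.add_self_eq_zero]
      · have h1 : X * Q (k + 1) * Q (j + 1) = X * Q (j + 1) * Q (k + 1) := by ring
        rw [h1, hXQ, mul_comm (Q (j + 2)), mul_comm (Q (j + 1)), mul_comm (Q j),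
          mul_comm (Q k), orth' k (j + 2) le_rfl (by omega), orth' k (j + 1) le_rfl (by omega),
          orth' k j le_rfl (by omega), orth' j k (by omega) (by omega)]
        rw [if_neg (show ¬ k + 1 = j + 1 by omega), if_neg (show ¬ k + 1 = j by omega),
          if_neg (show ¬ k = j by omega)]
        by_cases e : j + 1 = k
        · rw [if_pos (show k + 1 = j + 2 by omega), if_pos e]
          simp [CharTwo.add_self_eq_zero]
        · rw [if_neg (show ¬ k + 1 = j + 2 by omega), if_neg e]
          simp
    have norm_sq : L (Q (k + 2) * Q (k + 2)) = 1 := by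
      have hfrob := hsq (Q (k + 1))
      have hexp : Q (k + 2) * Q (k + 2) = X ^ 2 * Q (k + 1) ^ 2 +
          C (L (X * Q (k + 1) ^ 2)) * (Q (k + 1) * Q (k + 1)) + Q k * Q k := by
        have ha : C (L (X * Q (k + 1) ^ 2)) ^ 2 = C (L (X * Q (k + 1) ^ 2)) := by
          rw [← C_pow, ZMod.pow_card]
        rw [← sq, hrec, CharTwo.add_sq, mul_pow, CharTwo.add_sq, ha]
        ring
      rw [hexp, map_add, map_add, hC, orth k k le_rfl le_rfl,
        if_pos rfl, mul_one, add_comm (L (X ^ 2 * _)), hfrob]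
      match k with
      | 0 => simp [hQ0, hQ1, h1]
      | k + 1 =>
        have h1 := orth (k + 1) 0 le_rfl (by omega)
        rw [zero_add, hQ1, mul_one] at h1
        rw [h1, orth k k (by omega) (by omega)]
        simp
    intro j hj
    rcases hj.eq_or_lt with rfl | hj
    · simpa using norm_sq
    · rw [lower j (by omega), if_neg (by omega)]

/-- The orthogonal polynomials are orthonormal. -/
lemma momentFunctional_orthogonalPoly_mul (h0 : d 0 = 1)
    (hd : ∀ n, d n = d (2 * n + 1) + d (2 * n + 2)) (k : ℕ) :
    ∀ j ≤ k, momentFunctional d (orthogonalPoly d (k + 1) * orthogonalPoly d (j + 1)) =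
      if j = k then 1 else 0 :=
  orthonormal_of_recurrence (momentFunctional d) (orthogonalPoly d)
    ((momentFunctional_one d).trans h0) (momentFunctional_mul_sq d hd) (by rw [orthogonalPoly])
    (by rw [orthogonalPoly]) (fun k => by rw [orthogonalPoly]) k

lemma momentFunctional_mul_eq_sum {n : ℕ} {p q : (ZMod 2)[X]} (hp : p.natDegree < n)
    (hq : q.natDegree < n) : momentFunctional d (p * q) =
      ∑ l : Fin n, (∑ k : Fin n, p.coeff k * d (k + l)) * q.coeff l := by
  conv_lhs => rw [p.as_sum_range_C_mul_X_pow' hp, q.as_sum_range_C_mul_X_pow' hq]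
  rw [Finset.sum_range, Finset.sum_range, Finset.sum_mul_sum, Finset.sum_comm, map_sum]
  refine Finset.sum_congr rfl fun l _ => ?_
  rw [map_sum, Finset.sum_mul]
  refine Finset.sum_congr rfl fun k _ => ?_
  have h : C (p.coeff k) * X ^ (k : ℕ) * (C (q.coeff l) * X ^ (l : ℕ)) =
      C (p.coeff k) * (C (q.coeff l) * X ^ (k + l : ℕ)) := by ring
  rw [h, momentFunctional_C_mul, momentFunctional_C_mul, momentFunctional_X_pow]
  ring

/-- All Hankel determinants over `𝔽₂` of a sequence with `d 0 = 1` and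
`d n = d (2 * n + 1) + d (2 * n + 2)` are nonzero. -/
lemma det_hankel_ne_zero (h0 : d 0 = 1) (hd : ∀ n, d n = d (2 * n + 1) + d (2 * n + 2)) (n : ℕ) :
    (Matrix.of fun i j : Fin n => d (i.1 + j.1)).det ≠ 0 := by
  set H := Matrix.of fun i j : Fin n => d (i.1 + j.1) with hH
  set U := Matrix.of fun i k : Fin n => (orthogonalPoly d (i.1 + 1)).coeff k.1 with hU
  have hdeg (i : Fin n) : (orthogonalPoly d (i.1 + 1)).natDegree < n :=
    (natDegree_orthogonalPoly_succ_le d i).trans_lt i.2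
  have key : U * H * U.transpose = 1 := by
    ext i j
    have h : (U * H * U.transpose) i j = momentFunctional d
        (orthogonalPoly d (i.1 + 1) * orthogonalPoly d (j.1 + 1)) := by
      rw [momentFunctional_mul_eq_sum d (hdeg i) (hdeg j)]
      simp [Matrix.mul_apply, hH, hU]
    rw [h, Matrix.one_apply]
    rcases le_total j.1 i.1 with hji | hij
    · rw [momentFunctional_orthogonalPoly_mul d h0 hd _ _ hji]
      simp only [Fin.ext_iff, eq_comm]
    · rw [mul_comm, momentFunctional_orthogonalPoly_mul d h0 hd _ _ hij]
      simp only [Fin.ext_iff]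
  intro hdet
  have h1 := congrArg Matrix.det key
  rw [Matrix.det_mul, Matrix.det_mul, hdet, Matrix.det_one] at h1
  simp at h1

end Moments

/-- Differencing consecutive rows of a Hankel determinant of `1 - 2 b` extracts a power of two. -/
lemma hankel_succ_eq_two_pow_mul (f b : ℕ → ℤ) (hb : ∀ k, f k = 1 - 2 * b k) (m : ℕ) :
    hankel f (m + 1) = 2 ^ m * Matrix.det (Matrix.of fun i j : Fin (m + 1) =>
      (Fin.cases (f j) (fun i' : Fin m => b (i' + j) - b (i' + j + 1)) i : ℤ)) := by
  have hprod : ∏ i : Fin (m + 1), (Fin.cases 1 (fun _ => 2) i : ℤ) = 2 ^ m := by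
    rw [Fin.prod_univ_succ]; simp
  rw [hankel, ← hprod, ← Matrix.det_mul_column]
  refine Matrix.det_eq_of_forall_row_eq_smul_add_pred (fun _ => 1) (fun j => by simp) fun i j => ?_
  simp only [Matrix.of_apply, Fin.val_succ, Fin.val_castSucc, Fin.cases_succ, hb]
  rw [show i.1 + 1 + j.1 = i.1 + j.1 + 1 by ring]
  ring

/-- Differencing consecutive columns reduces the remaining determinant to a smaller Hankel
determinant modulo two. -/
lemma det_differences_cast (f b : ℕ → ℤ) (hb : ∀ k, f k = 1 - 2 * b k) (m : ℕ) :
    ((Matrix.det (Matrix.of fun i j : Fin (m + 1) =>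
      (Fin.cases (f j) (fun i' : Fin m => b (i' + j) - b (i' + j + 1)) i : ℤ)) : ℤ) : ZMod 2) =
    (Matrix.of fun i j : Fin m => (b (i.1 + j.1) : ZMod 2) + b (i.1 + j.1 + 2)).det := by
  have two : (2 : ZMod 2) = 0 := rfl
  have hf (k : ℕ) : (f k : ZMod 2) = 1 := by rw [hb]; push_cast; rw [two]; ring
  rw [Int.cast_det]
  rw [Matrix.det_eq_of_forall_col_eq_smul_add_pred (B := Matrix.of fun i j : Fin (m + 1) =>
      (Fin.cases (Fin.cases 1 (fun _ => 0) j)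
        (fun i' : Fin m => Fin.cases ((b i' : ZMod 2) - b (i' + 1))
          (fun j' : Fin m => (b (i' + j') : ZMod 2) + b (i' + j' + 2)) j) i : ZMod 2))
      (fun _ => 1)]
  · rw [Matrix.det_succ_row_zero, Fin.sum_univ_succ]
    simp [Matrix.submatrix]
  · intro i
    cases i using Fin.cases <;> simp [hf]
  · intro i j
    cases i using Fin.cases with
    | zero => simp [hf]
    | succ i =>
      simp only [Matrix.map_apply, Matrix.of_apply, Fin.cases_succ, Fin.val_succ,
        Fin.val_castSucc, ← add_assoc]
      push_cast
      linear_combination (b (i + j + 1) - b (i + j) - b (i + j + 2) : ZMod 2) * two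

/-- A criterion for a `±1` sequence to be Apwenian. -/
lemma apwenian_of_mul_eq_neg_one (f : ℕ → ℤ) (hf : ∀ k, f k = 1 ∨ f k = -1)
    (hmul : ∀ n, f n * f (n + 1) * f (2 * n + 1) * f (2 * n + 2) = -1) (n : ℕ) (hn : 0 < n) :
    (2 : ℤ) ^ (n - 1) ∣ hankel f n ∧ Odd (hankel f n / 2 ^ (n - 1)) := by
  obtain ⟨m, rfl⟩ : ∃ m, n = m + 1 := ⟨n - 1, by omega⟩
  have hex (k : ℕ) : ∃ c : ℤ, f k = 1 - 2 * c ∧ (c = 0 ∨ c = 1) := by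
    rcases hf k with h | h
    · exact ⟨0, by omega, by simp⟩
    · exact ⟨1, by omega, by simp⟩
  choose b hb hb01 using hex
  have two : (2 : ZMod 2) = 0 := rfl
  have hsum (n : ℕ) : (b n + b (n + 1) + b (2 * n + 1) + b (2 * n + 2) : ZMod 2) = 1 := by
    have h := hmul n
    simp only [hb] at h
    rcases hb01 n with h1 | h1 <;> rcases hb01 (n + 1) with h2 | h2 <;>
      rcases hb01 (2 * n + 1) with h3 | h3 <;> rcases hb01 (2 * n + 2) with h4 | h4 <;>
      rw [h1, h2, h3, h4] at h ⊢ <;> first | rfl | (norm_num at h)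
  set d : ℕ → ZMod 2 := fun k => b k + b (k + 2) with hd
  have h0 : d 0 = 1 := by
    have h := hsum 0
    simp only [hd]
    norm_num at h ⊢
    linear_combination h - b 1 * two
  have hrec (n : ℕ) : d n = d (2 * n + 1) + d (2 * n + 2) := by
    have h1 := hsum n
    have h2 := hsum (n + 1)
    rw [show 2 * (n + 1) + 1 = 2 * n + 1 + 2 by ring,
      show 2 * (n + 1) + 2 = 2 * n + 2 + 2 by ring] at h2
    simp only [hd]
    rw [show n + 2 = n + 1 + 1 from rfl]
    linear_combination h1 + h2 - (b (n + 1) + b (2 * n + 1) + b (2 * n + 2) + b (2 * n + 1 + 2) +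
      b (2 * n + 2 + 2) - 1 : ZMod 2) * two
  have hne := det_hankel_ne_zero d h0 hrec m
  rw [hd, ← det_differences_cast f b hb m] at hne
  rw [hankel_succ_eq_two_pow_mul f b hb, Nat.add_sub_cancel,
    Int.mul_ediv_cancel_left _ (by positivity)]
  refine ⟨dvd_mul_right _ _, ?_⟩
  rw [← Int.not_even_iff_odd, even_iff_two_dvd]
  intro hdvd
  exact hne ((ZMod.intCast_zmod_eq_zero_iff_dvd _ 2).mpr (by exact_mod_cast hdvd))

/-- The pattern of the `13`-multiplicative sequence `f`. -/
def pattern13 : Fin 13 → ℤ := ![1, -1, -1, 1, -1, -1, -1, -1, -1, 1, -1, -1, 1]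

lemma pattern13_eq_one_or (i : Fin 13) : pattern13 i = 1 ∨ pattern13 i = -1 := by
  revert i; decide

lemma pattern13_mul (r : Fin 12) :
    pattern13 r.castSucc * pattern13 r.succ * pattern13 (Fin.ofNat 13 (2 * r + 1)) *
      pattern13 (Fin.ofNat 13 (2 * r + 2)) = -1 := by
  revert r; decide

lemma eq_one_or_eq_neg_one_of_pattern13 (f : ℕ → ℤ) (h0 : f 0 = 1)
    (hf : ∀ n : ℕ, ∀ i : Fin 13, f (13 * n + (i : ℕ)) = pattern13 i * f n) (k : ℕ) :
    f k = 1 ∨ f k = -1 := by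
  induction k using Nat.strong_induction_on with
  | _ k ih =>
  rcases Nat.eq_zero_or_pos k with rfl | hk
  · exact Or.inl h0
  · have h := hf (k / 13) ⟨k % 13, Nat.mod_lt _ (by norm_num)⟩
    rw [show 13 * (k / 13) + k % 13 = k from Nat.div_add_mod k 13] at h
    rw [h]
    rcases pattern13_eq_one_or ⟨k % 13, Nat.mod_lt _ (by norm_num)⟩ with h1 | h1 <;>
      rcases ih (k / 13) (by omega) with h2 | h2 <;> rw [h1, h2] <;> norm_num

lemma mul_eq_neg_one_of_pattern13 (f : ℕ → ℤ) (h0 : f 0 = 1)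
    (hf : ∀ n : ℕ, ∀ i : Fin 13, f (13 * n + (i : ℕ)) = pattern13 i * f n) (n : ℕ) :
    f n * f (n + 1) * f (2 * n + 1) * f (2 * n + 2) = -1 := by
  have step (k q : ℕ) (i : Fin 13) (hk : k = 13 * q + (i : ℕ)) : f k = pattern13 i * f q :=
    hk ▸ hf q i
  have hsq (k : ℕ) : f k * f k = 1 := by
    rcases eq_one_or_eq_neg_one_of_pattern13 f h0 hf k with h | h <;> rw [h] <;> rfl
  induction n using Nat.strong_induction_on with
  | _ n ih =>
  obtain ⟨m, r, hr, rfl⟩ : ∃ m r, r < 13 ∧ n = 13 * m + r :=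
    ⟨n / 13, n % 13, Nat.mod_lt _ (by norm_num), (Nat.div_add_mod n 13).symm⟩
  rcases (Nat.lt_succ_iff_lt_or_eq.mp hr) with hr | rfl
  · -- without a carry, `n` and `n + 1` share a quotient, and so do `2n + 1` and `2n + 2`
    have hv := pattern13_mul ⟨r, hr⟩
    rw [step (13 * m + r) m (Fin.castSucc ⟨r, hr⟩) rfl,
      step (13 * m + r + 1) m (Fin.succ ⟨r, hr⟩) rfl,
      step (2 * (13 * m + r) + 1) (2 * m + (2 * r + 1) / 13) (Fin.ofNat 13 (2 * r + 1))
        (by simp only [Fin.val_ofNat]; omega),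
      step (2 * (13 * m + r) + 2) (2 * m + (2 * r + 1) / 13) (Fin.ofNat 13 (2 * r + 2))
        (by simp only [Fin.val_ofNat]; omega)]
    linear_combination hv * (f m * f m) * (f (2 * m + (2 * r + 1) / 13) ^ 2) -
      hsq m - f m * f m * (hsq (2 * m + (2 * r + 1) / 13))
  · have hm := ih m (by omega)
    rw [step (13 * m + 12) m 12 rfl, step (13 * m + 12 + 1) (m + 1) 0 rfl,
      step (2 * (13 * m + 12) + 1) (2 * m + 1) 12 (by simp; omega),
      step (2 * (13 * m + 12) + 2) (2 * m + 2) 0 (by simp; omega)]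
    have h12 : pattern13 12 = 1 := rfl
    have h00 : pattern13 0 = 1 := rfl
    rw [h12, h00]
    linear_combination hm

/-- The sequence `f` associated with `v = ![1, -1, -1, 1, -1, -1, -1, -1, -1, 1, -1, -1, 1]` (d = 13) is Apwenian. -/
theorem F13_apwenian (f : ℕ → ℤ)
    (h0 : f 0 = 1)
    (hf : ∀ n : ℕ, ∀ i : Fin 13, f (13 * n + (i : ℕ)) = ![1, -1, -1, 1, -1, -1, -1, -1, -1, 1, -1, -1, 1] i * f n) :
    ∀ n : ℕ, 0 < n →
      (2 : ℤ) ^ (n - 1) ∣ hankel f n ∧ Odd (hankel f n / 2 ^ (n - 1)) := by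
  exact apwenian_of_mul_eq_neg_one f (eq_one_or_eq_neg_one_of_pattern13 f h0 hf)
    (mul_eq_neg_one_of_pattern13 f h0 hf)
end

section
/- The sequence f defined from v = (1,−1,−1,1,−1,1,1,1,1,1,1,1,−1,1,−1,−1,1) with d = 17 is Apwenian: for every positive integer n, 2^(n−1) divides the Hankel determinant H_n(f) and H_n(f)/2^(n−1) is an odd integer. -/
open Polynomial in
/-- A linear functional with `L 1 = 1` and `L ((X² + X) p²) = L p` on `𝔽₂[X]` has nondegenerate
Hankel forms. -/
theorem eq_zero_of_forall_X_pow_mul_eq_zero (L : (ZMod 2)[X] →ₗ[ZMod 2] ZMod 2) (h1 : L 1 = 1)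
    (hL : ∀ p, L ((X ^ 2 + X) * p ^ 2) = L p) (n : ℕ) (a : (ZMod 2)[X]) (hdeg : a.degree < n)
    (ha : ∀ i < n, L (X ^ i * a) = 0) : a = 0 := by
  induction n generalizing a with
  | zero => simpa using hdeg
  | succ n ih =>
    have hmul : ∀ b : (ZMod 2)[X], b.degree < ((n + 1 : ℕ) : WithBot ℕ) → L (b * a) = 0 := by
      intro b hb
      have hb' : b.natDegree < n + 1 := by
        by_cases h : b = 0
        · simp [h]
        · exact (natDegree_lt_iff_degree_lt h).2 hb
      rw [b.as_sum_range' (n + 1) hb', Finset.sum_mul, map_sum]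
      refine Finset.sum_eq_zero fun i hi => ?_
      rw [← C_mul_X_pow_eq_monomial, mul_assoc, ← smul_eq_C_mul, map_smul,
        ha i (Finset.mem_range.1 hi), smul_zero]
    have hdiv := divX_mul_X_add a
    have hp : a.divX.degree < n := by
      refine (degree_lt_iff_coeff_zero _ _).2 fun k hk => ?_
      rw [coeff_divX]
      exact (degree_lt_iff_coeff_zero _ _).1 hdeg _ (by omega)
    have hpa := hmul _ (hp.trans (by exact_mod_cast n.lt_succ_self))
    have haa := hmul _ hdeg
    generalize a.divX = p at hdiv hp hpa
    have hc : a.coeff 0 = 0 ∨ a.coeff 0 = 1 := by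
      generalize a.coeff 0 = c
      revert c
      decide
    have h2 : (2 : (ZMod 2)[X]) = 0 := CharTwo.two_eq_zero
    rcases hc with hc | hc <;> rw [hc] at hdiv
    · have hLp : L p = 0 := by
        rw [← hL p, show (X ^ 2 + X) * p ^ 2 = a * a + p * a by rw [← hdiv, C_0]; ring,
          map_add, haa, hpa, add_zero]
      have hp0 : p = 0 := by
        refine ih p hp fun i hi => ?_
        rcases i with _ | i
        · simpa using hLp
        · have := ha i (by omega)
          rwa [← hdiv, C_0, add_zero, mul_comm p, ← mul_assoc, ← pow_succ] at this
      rw [← hdiv, hp0]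
      simp
    · have hLp : L p = 1 + L p := by
        nth_rw 1 [← hL p]
        rw [show (X ^ 2 + X) * p ^ 2 = a * a + p * a + (1 + p) by
          rw [← hdiv, C_1]; linear_combination (-(p * X) - p - 1) * h2]
        rw [map_add, map_add, map_add, haa, hpa, h1, add_zero, zero_add]
      simp at hLp

open Polynomial in
/-- The quadratic functional equation of a functional on `𝔽₂[X]` follows from its moments. -/
theorem map_X_sq_add_X_mul_sq (L : (ZMod 2)[X] →ₗ[ZMod 2] ZMod 2)
    (hL : ∀ k, L (X ^ (2 * k + 2)) + L (X ^ (2 * k + 1)) = L (X ^ k)) (p : (ZMod 2)[X]) :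
    L ((X ^ 2 + X) * p ^ 2) = L p := by
  induction p using Polynomial.induction_on' with
  | add p q hp hq => rw [CharTwo.add_sq, mul_add, map_add, map_add, hp, hq]
  | monomial k c =>
    have hc : c ^ 2 = c := by
      revert c
      decide
    rw [← C_mul_X_pow_eq_monomial, mul_pow, ← C_pow, hc,
      show (X ^ 2 + X) * (C c * (X ^ k) ^ 2) = C c * (X ^ (2 * k + 2) + X ^ (2 * k + 1)) by ring,
      ← smul_eq_C_mul, ← smul_eq_C_mul, map_smul, map_smul, map_add, hL]

open Polynomial in
/-- A vector over `𝔽₂` orthogonal to the all-ones vector and to the consecutive differences of the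
Hankel rows of `g` vanishes. -/
theorem eq_zero_of_sum_hankel_row_sub_mul_eq_zero (g : ℕ → ZMod 2)
    (hg : ∀ m, g (2 * m + 1) + g (2 * m + 2) + g m + g (m + 1) = 1) (m : ℕ)
    (v : Fin (m + 1) → ZMod 2) (hv : ∑ j, v j = 0)
    (hgv : ∀ i < m, ∑ j : Fin (m + 1), (g (i + j) - g (i + 1 + j)) * v j = 0) : v = 0 := by
  let M : (ZMod 2)[X] →ₗ[ZMod 2] ZMod 2 := Polynomial.lsum fun k => g k • LinearMap.id
  have hM : ∀ k, M (X ^ k) = g k := fun k => by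
    simp [M, Polynomial.lsum, ← monomial_one_right_eq_X_pow, sum_monomial_index]
  have h2 : (2 : (ZMod 2)[X]) = 0 := CharTwo.two_eq_zero
  let L : (ZMod 2)[X] →ₗ[ZMod 2] ZMod 2 := M ∘ₗ LinearMap.mulLeft (ZMod 2) ((X - C 1) ^ 2)
  have hL : ∀ k, L (X ^ k) = g k + g (k + 2) := fun k => by
    rw [← hM, ← hM, ← map_add]
    simp only [L, LinearMap.comp_apply, LinearMap.mulLeft_apply, C_1]
    congr 1
    linear_combination (- X ^ (k + 1)) * h2
  have h2' : (2 : ZMod 2) = 0 := CharTwo.two_eq_zero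
  have h1 : L 1 = 1 := by
    rw [← pow_zero X, hL]
    linear_combination hg 0 - g 1 * h2'
  have hLsq := map_X_sq_add_X_mul_sq L fun k => by
    rw [hL, hL, hL]
    have e1 := hg k
    have e2 := hg (k + 1)
    rw [show 2 * (k + 1) + 1 = 2 * k + 3 by ring, show 2 * (k + 1) + 2 = 2 * k + 4 by ring,
      add_assoc k] at e2
    rw [show 2 * k + 2 + 2 = 2 * k + 4 by ring, show 2 * k + 1 + 2 = 2 * k + 3 by ring]
    linear_combination e1 + e2 - (g k + g (k + 1) + g (k + 2) - 1) * h2'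
  set a : (ZMod 2)[X] := ∑ j : Fin (m + 1), C (v j) * X ^ (j : ℕ) with ha
  have hMa : ∀ i, M (X ^ i * a) = ∑ j : Fin (m + 1), g (i + j) * v j := fun i => by
    rw [ha, Finset.mul_sum, map_sum]
    refine Finset.sum_congr rfl fun j _ => ?_
    rw [mul_left_comm, ← pow_add, ← smul_eq_C_mul, map_smul, hM, smul_eq_mul, mul_comm]
  have hdeg : a.degree < (m + 1 : ℕ) := degree_sum_fin_lt v
  obtain ⟨q, hq⟩ : X - C 1 ∣ a := by
    rw [dvd_iff_isRoot, IsRoot, ha, eval_finsetSum]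
    simpa using hv
  have hq0 : q = 0 := by
    refine eq_zero_of_forall_X_pow_mul_eq_zero L h1 hLsq m q ?_ fun i hi => ?_
    · rw [hq, degree_mul, degree_X_sub_C] at hdeg
      by_cases h : q = 0
      · simp [h]
      · rw [degree_eq_natDegree h] at hdeg ⊢
        norm_cast at hdeg ⊢
        omega
    · have h := hgv i hi
      simp only [sub_mul, Finset.sum_sub_distrib] at h
      rw [← hMa, ← hMa, ← map_sub, ← neg_eq_zero, ← map_neg] at h
      rw [← h]
      simp only [L, LinearMap.comp_apply, LinearMap.mulLeft_apply]
      rw [hq, C_1]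
      congr 1
      ring
  rw [hq0, mul_zero] at hq
  ext j
  have hcoeff : a.coeff j = v j := by
    simp [ha, coeff_X_pow, Fin.val_inj]
  rw [← hcoeff, hq]
  simp

/-- A parity criterion for a `±1`-sequence `1 - 2g` to be Apwenian. -/
theorem exists_odd_hankel_eq (g : ℕ → ℤ)
    (hg : ∀ m, ((g (2 * m + 1) + g (2 * m + 2) + g m + g (m + 1) : ℤ) : ZMod 2) = 1) (m : ℕ) :
    ∃ d : ℤ, Odd d ∧ hankel (fun k => 1 - 2 * g k) (m + 1) = 2 ^ m * d := by
  let B : Matrix (Fin (m + 1)) (Fin (m + 1)) ℤ := Matrix.of fun i j =>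
    Fin.cases (1 - 2 * g j) (fun i => g (i + j) - g (i + 1 + j)) i
  refine ⟨B.det, ?_, ?_⟩
  · rw [← Int.not_even_iff_odd, even_iff_two_dvd]
    intro h
    have h0 : (B.map (Int.castRingHom (ZMod 2))).det = 0 := by
      have := (ZMod.intCast_zmod_eq_zero_iff_dvd B.det 2).2 (by exact_mod_cast h)
      rwa [← eq_intCast (Int.castRingHom (ZMod 2)), RingHom.map_det] at this
    obtain ⟨v, hv, hBv⟩ := Matrix.exists_mulVec_eq_zero_iff.2 h0
    have h2 : (2 : ZMod 2) = 0 := CharTwo.two_eq_zero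
    refine hv (eq_zero_of_sum_hankel_row_sub_mul_eq_zero (fun k => (g k : ZMod 2))
      (fun m => by simpa using hg m) m v ?_ fun i hi => ?_)
    · simpa [B, Matrix.mulVec, dotProduct, h2] using congrFun hBv 0
    · simpa [B, Matrix.mulVec, dotProduct] using congrFun hBv (Fin.succ ⟨i, hi⟩)
  · have hprod : ∏ i : Fin (m + 1), (Fin.cons 1 (fun _ => 2) : Fin (m + 1) → ℤ) i = 2 ^ m := by
      simp [Fin.prod_univ_succ]
    rw [← hprod, ← Matrix.det_mul_column, hankel]
    refine Matrix.det_eq_of_forall_row_eq_smul_add_pred (fun _ => 1) (fun j => ?_) fun i j => ?_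
    · simp [B]
    · simp [B]
      ring

/-- The sequence `f` associated with `v = ![1, -1, -1, 1, -1, 1, 1, 1, 1, 1, 1, 1, -1, 1, -1, -1, 1]` (d = 17) is Apwenian. -/
theorem F17a_apwenian (f : ℕ → ℤ)
    (h0 : f 0 = 1)
    (hf : ∀ n : ℕ, ∀ i : Fin 17, f (17 * n + (i : ℕ)) = ![1, -1, -1, 1, -1, 1, 1, 1, 1, 1, 1, 1, -1, 1, -1, -1, 1] i * f n) :
    ∀ n : ℕ, 0 < n →
      (2 : ℤ) ^ (n - 1) ∣ hankel f n ∧ Odd (hankel f n / 2 ^ (n - 1)) := by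
  obtain ⟨v, hv⟩ : ∃ v : Fin 17 → ℤ,
      v = ![1, -1, -1, 1, -1, 1, 1, 1, 1, 1, 1, 1, -1, 1, -1, -1, 1] := ⟨_, rfl⟩
  rw [← hv] at hf
  have hsq : ∀ m, f m ^ 2 = 1 := by
    intro m
    induction m using Nat.strong_induction_on with
    | _ m ih =>
      rcases m.eq_zero_or_pos with rfl | hm
      · simp [h0]
      · have h := hf (m / 17) ⟨m % 17, Nat.mod_lt _ (by norm_num)⟩
        rw [Nat.div_add_mod] at h
        rw [h, mul_pow, ih _ (by omega), mul_one]
        generalize (⟨m % 17, _⟩ : Fin 17) = i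
        rw [hv]
        revert i
        decide
  have hprod : ∀ m, f (2 * m + 1) * f (2 * m + 2) * f m * f (m + 1) = -1 := by
    intro m
    induction m using Nat.strong_induction_on with
    | _ m ih =>
      have hf' : ∀ (k n : ℕ) (i : Fin 17), k = 17 * n + (i : ℕ) → f k = v i * f n := by
        rintro _ n i rfl
        exact hf n i
      obtain ⟨q, r, hr, rfl⟩ : ∃ q r, r < 17 ∧ m = 17 * q + r :=
        ⟨m / 17, m % 17, Nat.mod_lt _ (by norm_num), (Nat.div_add_mod m 17).symm⟩
      rcases Nat.lt_succ_iff_lt_or_eq.1 hr with hr' | rfl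
      · have hc : ∀ r : Fin 16, v ⟨(2 * r + 1) % 17, Nat.mod_lt _ (by norm_num)⟩ *
            v ⟨(2 * r + 2) % 17, Nat.mod_lt _ (by norm_num)⟩ * v r.castSucc * v r.succ = -1 := by
          rw [hv]
          decide
        specialize hc ⟨r, hr'⟩
        rw [hf' (2 * (17 * q + r) + 1) (2 * q + (2 * r + 1) / 17)
            ⟨(2 * r + 1) % 17, Nat.mod_lt _ (by norm_num)⟩ (by dsimp only; omega),
          hf' (2 * (17 * q + r) + 2) (2 * q + (2 * r + 1) / 17)
            ⟨(2 * r + 2) % 17, Nat.mod_lt _ (by norm_num)⟩ (by dsimp only; omega),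
          hf' (17 * q + r) q (Fin.castSucc ⟨r, hr'⟩) rfl,
          hf' (17 * q + r + 1) q (Fin.succ ⟨r, hr'⟩) rfl]
        have s1 := hsq q
        have s2 := hsq (2 * q + (2 * r + 1) / 17)
        linear_combination f q ^ 2 * f (2 * q + (2 * r + 1) / 17) ^ 2 * hc -
          f (2 * q + (2 * r + 1) / 17) ^ 2 * s1 - s2
      · have hq := ih q (by omega)
        rw [hf' (2 * (17 * q + 16) + 1) (2 * q + 1) 16 (by simp; omega),
          hf' (2 * (17 * q + 16) + 2) (2 * q + 2) 0 (by simp; omega),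
          hf' (17 * q + 16) q 16 (by simp),
          hf' (17 * q + 16 + 1) (q + 1) 0 (by simp; omega)]
        simpa [hv] using hq
  have hf1 : ∀ k, f k = 1 ∨ f k = -1 := fun k => sq_eq_one_iff.1 (hsq k)
  have hg : f = fun k => 1 - 2 * ((1 - f k) / 2) := by
    funext k
    rcases hf1 k with h | h <;> simp [h]
  intro n hn
  obtain ⟨m, rfl⟩ := Nat.exists_eq_succ_of_ne_zero hn.ne'
  obtain ⟨d, hd, hdet⟩ := exists_odd_hankel_eq (fun k => (1 - f k) / 2) (fun m => by
    have h := hprod m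
    rcases hf1 (2 * m + 1) with h1 | h1 <;> rcases hf1 (2 * m + 2) with h2 | h2 <;>
      rcases hf1 m with h3 | h3 <;> rcases hf1 (m + 1) with h4 | h4 <;>
      rw [h1, h2, h3, h4] at h ⊢ <;> first | (norm_num at h; done) | decide) m
  rw [← hg] at hdet
  rw [Nat.succ_eq_add_one, hdet, Nat.add_sub_cancel, Int.mul_ediv_cancel_left _ (by positivity)]
  exact ⟨dvd_mul_right _ _, hd⟩
end

section
/- The sequence f defined from v = (1,−1,−1,−1,1,1,−1,1,1,1,−1,1,1,−1,−1,−1,1) with d = 17 is Apwenian: for every positive integer n, 2^(n−1) divides the Hankel determinant H_n(f) and H_n(f)/2^(n−1) is an odd integer. -/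
open Polynomial

/-- If a linear functional `L` on `𝔽₂[X]` satisfies `L 1 = 1` and `L (X (X + 1) q²) = L q`, then the
form `(u, v) ↦ L (u v)` is nondegenerate on the polynomials of degree less than `m`. -/
theorem eq_zero_of_forall_functional_mul_eq_zero (L : (ZMod 2)[X] →ₗ[ZMod 2] ZMod 2)
    (h_one : L 1 = 1) (h_sq : ∀ q, L (X * (X + 1) * q ^ 2) = L q) (m : ℕ) (u : (ZMod 2)[X])
    (hum : u.natDegree < m) (hu : ∀ v : (ZMod 2)[X], v.natDegree < m → L (u * v) = 0) :
    u = 0 := by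
  induction hd : u.natDegree using Nat.strong_induction_on generalizing u with
  | _ d ih =>
  subst hd
  obtain ⟨w, hw⟩ : ∃ w, u = (X + 1) * w + C (u.eval 1) := by
    obtain ⟨w, hw⟩ := X_sub_C_dvd_sub_C_eval (a := (1 : ZMod 2)) (p := u)
    have h_char : (X - C 1 : (ZMod 2)[X]) = X + 1 := by
      rw [CharTwo.sub_eq_add, map_one]
    exact ⟨w, by rw [← h_char, ← hw]; ring⟩
  generalize u.eval 1 = α at hw
  by_cases hw0 : w = 0
  · have h := hu 1 (by simpa using by omega)
    rw [hw, hw0, mul_zero, zero_add, mul_one, ← mul_one (C α), ← smul_eq_C_mul, map_smul,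
      h_one, smul_eq_mul, mul_one] at h
    simp [hw, hw0, h]
  have h_monic : (X + 1 : (ZMod 2)[X]).Monic := monic_X_add_C 1
  have h_deg_X : (X + 1 : (ZMod 2)[X]).natDegree = 1 := natDegree_X_add_C 1
  have h_deg : u.natDegree = w.natDegree + 1 := by
    rw [hw, natDegree_add_C, h_monic.natDegree_mul' hw0, h_deg_X, add_comm]
  have h_mul (v : (ZMod 2)[X]) (hv : v.natDegree < m) : L ((X + 1) * w * v) = α * L v := by
    have h := hu v hv
    rw [hw, add_mul, map_add, ← smul_eq_C_mul, map_smul, smul_eq_mul] at h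
    exact CharTwo.add_eq_zero.mp h
  have h_one' : L (X * w) + L w = α := by
    have h := h_mul 1 (by simpa using by omega)
    rwa [h_one, mul_one, mul_one, add_mul, one_mul, map_add] at h
  have h_quad : L w = α * L (X * w) := by
    rw [← h_mul (X * w) (by rw [natDegree_X_mul hw0]; omega), ← h_sq w]
    congr 1
    ring
  have h_zero : α = 0 ∧ L w = 0 := by
    generalize L w = β at *
    generalize L (X * w) = γ at *
    clear * - h_one' h_quad
    revert α β γ
    decide
  obtain ⟨rfl, hLw⟩ := h_zero
  refine absurd (ih w.natDegree (by omega) w (by omega) (fun v hv ↦ ?_) rfl) hw0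
  obtain ⟨v', hv'⟩ := X_sub_C_dvd_sub_C_eval (a := (1 : ZMod 2)) (p := v)
  have h_split : v = (X + 1) * v' + C (v.eval 1) := by
    rw [CharTwo.sub_eq_add (X : (ZMod 2)[X]), map_one] at hv'
    rw [← hv']; ring
  have hv'_deg : v'.natDegree < m := by
    by_cases hv0 : v' = 0
    · simpa [hv0] using by omega
    have := congrArg natDegree h_split
    rw [natDegree_add_C, h_monic.natDegree_mul' hv0, h_deg_X] at this
    omega
  have h := h_mul v' hv'_deg
  rw [h_split, mul_add, map_add, mul_comm w (C _), ← smul_eq_C_mul, map_smul, hLw, smul_zero,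
    add_zero, ← mul_assoc, mul_comm w, h, zero_mul]

/-- If `a n + a (2 n + 1) = 1` for all `n`, then the Hankel matrix of `a` over `𝔽₂` with `m` rows and
`m + 1` columns, bordered by a row of ones, is nonsingular. -/
theorem det_bordered_hankel_ne_zero (a : ℕ → ZMod 2) (ha : ∀ n, a n + a (2 * n + 1) = 1) (m : ℕ) :
    (Matrix.of (Fin.cons (fun _ ↦ 1) fun (i : Fin m) (j : Fin (m + 1)) ↦ a (i + j))).det ≠ 0 := by
  intro h_det
  obtain ⟨x, hx0, hx⟩ := Matrix.exists_mulVec_eq_zero_iff.mpr h_det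
  let A : (ZMod 2)[X] →ₗ[ZMod 2] ZMod 2 := (basisMonomials (ZMod 2)).constr (ZMod 2) a
  have hA (k : ℕ) : A (X ^ k) = a k := by
    rw [X_pow_eq_monomial, ← congrFun (coe_basisMonomials (R := ZMod 2)) k]
    exact (basisMonomials (ZMod 2)).constr_basis _ _ _
  let L : (ZMod 2)[X] →ₗ[ZMod 2] ZMod 2 := A ∘ₗ LinearMap.mulLeft (ZMod 2) (X + 1)
  have hL (q : (ZMod 2)[X]) : L q = A ((X + 1) * q) := rfl
  have hL_pow (k : ℕ) : L (X ^ k) = a (k + 1) + a k := by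
    rw [hL, add_mul, one_mul, ← pow_succ', map_add, hA, hA]
  have h_one : L 1 = 1 := by
    rw [← pow_zero X, hL_pow, add_comm]
    exact ha 0
  have h_sq (q : (ZMod 2)[X]) : L (X * (X + 1) * q ^ 2) = L q := by
    induction q using Polynomial.induction_on' with
    | add p q hp hq => rw [CharTwo.add_sq, mul_add, map_add, hp, hq, map_add]
    | monomial k c =>
      have h_pow : X * (X + 1) * (X ^ k) ^ 2 = (X ^ (2 * k + 1 + 1) + X ^ (2 * k + 1) : (ZMod 2)[X]) := by
        ring
      have hc : c ^ 2 = c := ZMod.pow_card c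
      rw [← C_mul_X_pow_eq_monomial, mul_pow, ← C_pow, hc, mul_left_comm, h_pow,
        ← smul_eq_C_mul, ← smul_eq_C_mul, map_smul, map_smul, map_add, hL_pow, hL_pow, hL_pow]
      have h₁ := ha k
      have h₂ := ha (k + 1)
      rw [show 2 * (k + 1) + 1 = 2 * k + 1 + 1 + 1 by ring] at h₂
      congr 1
      generalize a k = y₁ at *
      generalize a (k + 1) = y₂ at *
      generalize a (2 * k + 1) = y₃ at *
      generalize a (2 * k + 1 + 1) = y₄ at *
      generalize a (2 * k + 1 + 1 + 1) = y₅ at *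
      clear * - h₁ h₂
      revert y₁ y₂ y₃ y₄ y₅
      decide
  let u : (ZMod 2)[X] := ∑ j : Fin (m + 1), C (x j) * X ^ (j : ℕ)
  have hu_eval : u.eval 1 = 0 := by
    simpa [u, eval_finsetSum, Matrix.mulVec, dotProduct] using congrFun hx 0
  have hu_pow (i : ℕ) (hi : i < m) : A (u * X ^ i) = 0 := by
    have h := congrFun hx (Fin.succ ⟨i, hi⟩)
    simp only [Matrix.mulVec, dotProduct, Matrix.of_apply, Fin.cons_succ, Pi.zero_apply] at h
    rw [Finset.sum_mul, map_sum, ← h]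
    refine Finset.sum_congr rfl fun j _ ↦ ?_
    rw [mul_assoc, ← pow_add, ← smul_eq_C_mul, map_smul, hA, smul_eq_mul, mul_comm, add_comm i]
  have hu_coeff (j : Fin (m + 1)) : u.coeff j = x j := by
    simp [u, coeff_X_pow, Fin.val_inj]
  have hu_deg : u.natDegree ≤ m :=
    natDegree_sum_le_of_forall_le _ _ fun j _ ↦ (natDegree_C_mul_X_pow_le _ _).trans (by omega)
  obtain ⟨w, hw⟩ := X_sub_C_dvd_sub_C_eval (a := (1 : ZMod 2)) (p := u)
  rw [hu_eval, map_zero, sub_zero, CharTwo.sub_eq_add, map_one] at hw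
  have hw0 : w ≠ 0 := by
    rintro rfl
    refine hx0 (funext fun j ↦ ?_)
    rw [← hu_coeff, hw, mul_zero, coeff_zero, Pi.zero_apply]
  have hw_deg : w.natDegree < m := by
    have h_deg_X : (X + 1 : (ZMod 2)[X]).natDegree = 1 := natDegree_X_add_C 1
    have h_monic : (X + 1 : (ZMod 2)[X]).Monic := monic_X_add_C 1
    rw [hw, h_monic.natDegree_mul' hw0, h_deg_X] at hu_deg
    omega
  refine hw0 (eq_zero_of_forall_functional_mul_eq_zero L h_one h_sq m w hw_deg fun v hv ↦ ?_)
  rw [hL, ← mul_assoc, ← hw, v.as_sum_range' m hv, Finset.mul_sum, map_sum]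
  refine Finset.sum_eq_zero fun i hi ↦ ?_
  rw [← C_mul_X_pow_eq_monomial, mul_left_comm, ← smul_eq_C_mul, map_smul,
    hu_pow i (Finset.mem_range.mp hi), smul_zero]

/-- Subtracting consecutive rows of a Hankel matrix whose sequence has even differences `2 d k`. -/
theorem hankel_succ_eq_two_pow_mul_s6 (c d : ℕ → ℤ) (hd : ∀ k, c (k + 1) = c k + 2 * d k) (m : ℕ) :
    hankel c (m + 1) = 2 ^ m *
      (Matrix.of (Fin.cons (fun j : Fin (m + 1) ↦ c j) fun (i : Fin m) (j : Fin (m + 1)) ↦ d (i + j))).det := by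
  have h_scale := Matrix.det_mul_column (Fin.cons 1 fun _ : Fin m ↦ (2 : ℤ))
    (Matrix.of (Fin.cons (fun j : Fin (m + 1) ↦ c j) fun (i : Fin m) (j : Fin (m + 1)) ↦ d (i + j)))
  rw [Fin.prod_univ_succ, Fin.cons_zero, one_mul] at h_scale
  simp only [Fin.cons_succ, Finset.prod_const, Finset.card_univ, Fintype.card_fin] at h_scale
  rw [← h_scale, hankel]
  refine Matrix.det_eq_of_forall_row_eq_smul_add_pred (fun _ ↦ 1) (fun j ↦ ?_) fun i j ↦ ?_
  · simp
  · simp only [Matrix.of_apply, Fin.val_succ, Fin.val_castSucc, Fin.cons_succ]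
    rw [add_right_comm, hd]
    ring

/-- A `±1` sequence with `c n * c (n + 1) * c (2 n + 1) * c (2 n + 2) = -1` for all `n` is Apwenian. -/
theorem apwenian_of_forall_mul_eq_neg_one (c : ℕ → ℤ) (hc : ∀ n, c n = 1 ∨ c n = -1)
    (h : ∀ n, c n * c (n + 1) * (c (2 * n + 1) * c (2 * n + 2)) = -1) (n : ℕ) (hn : 0 < n) :
    (2 : ℤ) ^ (n - 1) ∣ hankel c n ∧ Odd (hankel c n / 2 ^ (n - 1)) := by
  obtain ⟨m, rfl⟩ := Nat.exists_eq_add_one_of_ne_zero hn.ne'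
  have h_diff (k : ℕ) : ∃ e, c (k + 1) = c k + 2 * e := by
    rcases hc k with h₁ | h₁ <;> rcases hc (k + 1) with h₂ | h₂ <;> rw [h₁, h₂]
    exacts [⟨0, rfl⟩, ⟨-1, rfl⟩, ⟨1, rfl⟩, ⟨0, rfl⟩]
  choose d hd using h_diff
  have hd_odd (k : ℕ) : Odd (d k + d (2 * k + 1)) := by
    have h₁ := hd k
    have h₂ := hd (2 * k + 1)
    have h₃ := h k
    rcases hc k with e₁ | e₁ <;> rcases hc (k + 1) with e₂ | e₂ <;>
      rcases hc (2 * k + 1) with e₃ | e₃ <;> rcases hc (2 * k + 2) with e₄ | e₄ <;>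
      simp only [e₁, e₂, e₃, e₄] at h₁ h₂ h₃ <;> grind
  rw [hankel_succ_eq_two_pow_mul_s6 c d hd, Nat.add_sub_cancel,
    Int.mul_ediv_cancel_left _ (by positivity)]
  refine ⟨dvd_mul_right _ _, ?_⟩
  rw [← Int.not_even_iff_odd, ← ZMod.intCast_eq_zero_iff_even, Int.cast_det]
  convert det_bordered_hankel_ne_zero (fun k ↦ (d k : ZMod 2)) (fun k ↦ ?_) m using 3
  · ext i j
    refine Fin.cases ?_ (fun i ↦ ?_) i
    · rcases hc j with e | e <;> simp [e]
    · simp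
  · exact_mod_cast ZMod.intCast_eq_one_iff_odd.mpr (hd_odd k)

/-- The sequence `f` associated with `v = ![1, -1, -1, -1, 1, 1, -1, 1, 1, 1, -1, 1, 1, -1, -1, -1, 1]` (d = 17) is Apwenian. -/
theorem F17b_apwenian (f : ℕ → ℤ)
    (h0 : f 0 = 1)
    (hf : ∀ n : ℕ, ∀ i : Fin 17, f (17 * n + (i : ℕ)) = ![1, -1, -1, -1, 1, 1, -1, 1, 1, 1, -1, 1, 1, -1, -1, -1, 1] i * f n) :
    ∀ n : ℕ, 0 < n →
      (2 : ℤ) ^ (n - 1) ∣ hankel f n ∧ Odd (hankel f n / 2 ^ (n - 1)) := by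
  have h_sign (n : ℕ) : f n = 1 ∨ f n = -1 := by
    induction n using Nat.strong_induction_on with
    | _ n ih =>
    rcases Nat.eq_zero_or_pos n with rfl | hn
    · exact Or.inl h0
    have h_rec := hf (n / 17) ⟨n % 17, Nat.mod_lt _ (by norm_num)⟩
    rw [Nat.div_add_mod] at h_rec
    have h_v : ∀ i : Fin 17, (![1, -1, -1, -1, 1, 1, -1, 1, 1, 1, -1, 1, 1, -1, -1, -1, 1] i : ℤ) = 1 ∨
        (![1, -1, -1, -1, 1, 1, -1, 1, 1, 1, -1, 1, 1, -1, -1, -1, 1] i : ℤ) = -1 := by decide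
    rcases h_v ⟨n % 17, Nat.mod_lt _ (by norm_num)⟩ with e | e <;>
      rcases ih (n / 17) (by omega) with e' | e' <;> rw [h_rec, e, e'] <;> simp
  refine apwenian_of_forall_mul_eq_neg_one f h_sign fun n ↦ ?_
  induction n using Nat.strong_induction_on with
  | _ n ih =>
  obtain ⟨k, i, hi, rfl⟩ : ∃ k i, i < 17 ∧ n = 17 * k + i :=
    ⟨n / 17, n % 17, Nat.mod_lt _ (by norm_num), (Nat.div_add_mod n 17).symm⟩
  have h_sq (j : ℕ) : f j * f j = 1 := by rcases h_sign j with e | e <;> rw [e] <;> rfl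
  by_cases h_last : i = 16
  · subst h_last
    rw [show 17 * k + 16 + 1 = 17 * (k + 1) + (0 : Fin 17) by simp; ring,
      show 2 * (17 * k + 16) + 1 = 17 * (2 * k + 1) + (16 : Fin 17) by simp; ring,
      show 2 * (17 * k + 16) + 2 = 17 * (2 * k + 2) + (0 : Fin 17) by simp; ring,
      show 17 * k + 16 = 17 * k + (16 : Fin 17) by simp, hf, hf, hf, hf]
    simpa using ih k (by omega)
  · obtain ⟨b, j, hj, hb⟩ : ∃ b j, j + 1 < 17 ∧ 2 * (17 * k + i) + 1 = 17 * b + j :=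
      ⟨(2 * (17 * k + i) + 1) / 17, (2 * i + 1) % 17, by omega, by omega⟩
    have h_i := hf k ⟨i, hi⟩
    have h_i' := hf k ⟨i + 1, by omega⟩
    have h_j := hf b ⟨j, by omega⟩
    have h_j' := hf b ⟨j + 1, hj⟩
    have h_v : ∀ i j : Fin 16, (2 * (i : ℕ) + 1) % 17 = j →
        (![1, -1, -1, -1, 1, 1, -1, 1, 1, 1, -1, 1, 1, -1, -1, -1, 1] i.castSucc : ℤ) *
        ![1, -1, -1, -1, 1, 1, -1, 1, 1, 1, -1, 1, 1, -1, -1, -1, 1] i.succ *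
        (![1, -1, -1, -1, 1, 1, -1, 1, 1, 1, -1, 1, 1, -1, -1, -1, 1] j.castSucc *
        ![1, -1, -1, -1, 1, 1, -1, 1, 1, 1, -1, 1, 1, -1, -1, -1, 1] j.succ) = -1 := by decide
    have h_ij := h_v ⟨i, by omega⟩ ⟨j, by omega⟩ (show (2 * i + 1) % 17 = j by omega)
    simp only [Fin.castSucc_mk, Fin.succ_mk] at h_ij
    simp only [← add_assoc, ← hb] at h_i h_i' h_j h_j'
    rw [h_i, h_i', h_j, h_j']
    linear_combination h_ij * (f k * f k) * (f b * f b) - h_sq k * (f b * f b) - h_sq b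
end

section
/- For every positive integer n, the Hankel determinant H_n(f) of the sequence f (the coefficient sequence of F_3) satisfies: H_n(f) ≡ 1 (mod 3) if n ≡ 1 or 2 (mod 4), and H_n(f) ≡ 2 (mod 3) if n ≡ 3 or 0 (mod 4). -/
/-- The coefficient of `x ^ k` in the Laurent polynomial `(x - 1 - x⁻¹) ^ n` over `ZMod 3`. -/
def laurentCoeff : ℕ → ℤ → ZMod 3
  | 0, k => if k = 0 then 1 else 0
  | n + 1, k => laurentCoeff n (k - 1) - laurentCoeff n k - laurentCoeff n (k + 1)

theorem laurentCoeff_succ (n : ℕ) (k : ℤ) :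
    laurentCoeff (n + 1) k =
      laurentCoeff n (k - 1) - laurentCoeff n k - laurentCoeff n (k + 1) := rfl

theorem laurentCoeff_of_lt (n : ℕ) (k : ℤ) (h : (n : ℤ) < k) : laurentCoeff n k = 0 := by
  induction n generalizing k with
  | zero => exact if_neg (by omega)
  | succ n ih =>
    push_cast at h
    rw [laurentCoeff_succ, ih _ (by omega), ih _ (by omega), ih _ (by omega)]
    ring

theorem laurentCoeff_self (n : ℕ) : laurentCoeff n n = 1 := by
  induction n with
  | zero => rfl
  | succ n ih =>
    rw [laurentCoeff_succ, laurentCoeff_of_lt n ((n + 1 : ℕ) : ℤ) (by push_cast; omega),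
      laurentCoeff_of_lt n (((n + 1 : ℕ) : ℤ) + 1) (by push_cast; omega)]
    simpa using ih

theorem laurentCoeff_neg (n k : ℕ) :
    laurentCoeff n (-k) = (-1) ^ k * laurentCoeff n k := by
  induction n generalizing k with
  | zero => by_cases hk : k = 0 <;> simp [laurentCoeff, hk]
  | succ n ih =>
    cases k with
    | zero => simp
    | succ k =>
      have h1 := ih k
      have h2 := ih (k + 1)
      have h3 := ih (k + 2)
      rw [laurentCoeff_succ, laurentCoeff_succ]
      push_cast at h1 h2 h3 ⊢
      rw [show -((k : ℤ) + 1) - 1 = -(k + 2) by ring, show -((k : ℤ) + 1) + 1 = -k by ring,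
        show (k : ℤ) + 1 - 1 = k by ring, show (k : ℤ) + 1 + 1 = k + 2 by ring, h1, h2, h3]
      ring

/-- The Frobenius identity `(x - 1 - x⁻¹) ^ 3 = x ^ 3 - 1 - x ^ (-3)`, read on coefficients. -/
theorem laurentCoeff_add_three (n : ℕ) (k : ℤ) :
    laurentCoeff (n + 3) k =
      laurentCoeff n (k - 3) - laurentCoeff n k - laurentCoeff n (k + 3) := by
  have h3 : (3 : ZMod 3) = 0 := rfl
  simp only [laurentCoeff_succ]
  linear_combination (norm := ring_nf)
    (2 * laurentCoeff n k - laurentCoeff n (k - 2) - laurentCoeff n (k + 2)) * h3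

theorem laurentCoeff_three_mul (n : ℕ) (k : ℤ) :
    laurentCoeff (3 * n) (3 * k) = laurentCoeff n k := by
  induction n generalizing k with
  | zero => simp [laurentCoeff]
  | succ n ih =>
    rw [mul_add_one, laurentCoeff_add_three, laurentCoeff_succ, ← ih, ← ih, ← ih]
    ring_nf

theorem laurentCoeff_three_mul_of_not_dvd (n : ℕ) (k : ℤ) (h : ¬ 3 ∣ k) :
    laurentCoeff (3 * n) k = 0 := by
  induction n generalizing k with
  | zero => exact if_neg (by omega)
  | succ n ih =>
    rw [mul_add_one, laurentCoeff_add_three, ih _ (by omega), ih _ (by omega), ih _ (by omega)]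
    ring

theorem laurentCoeff_zero_eq (f : ℕ → ℤ) (h0 : f 0 = 1)
    (hf : ∀ n : ℕ, f (3 * n) = f n ∧ f (3 * n + 1) = - f n ∧ f (3 * n + 2) = - f n) (n : ℕ) :
    laurentCoeff n 0 = f n := by
  induction n using Nat.strong_induction_on with
  | _ n ih =>
    obtain rfl | hn := Nat.eq_zero_or_pos n
    · simp [h0, laurentCoeff]
    have key : laurentCoeff (3 * (n / 3)) 0 = f (n / 3) := by
      rw [← ih _ (by omega), ← laurentCoeff_three_mul (n / 3) 0, mul_zero]
    have vanish := laurentCoeff_three_mul_of_not_dvd (n / 3)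
    obtain ⟨hf0, hf1, hf2⟩ := hf (n / 3)
    obtain h | h | h : n = 3 * (n / 3) ∨ n = 3 * (n / 3) + 1 ∨ n = 3 * (n / 3) + 2 := by omega
    · rw [h, hf0, key]
    · rw [h, hf1, laurentCoeff_succ, key, vanish _ (by omega), vanish _ (by omega)]
      push_cast
      ring
    · rw [h, hf2]
      simp only [laurentCoeff_succ]
      norm_num [key, vanish]

/-- The squared norm of the `k`-th orthogonal polynomial attached to the sequence. -/
def orthNorm (k : ℕ) : ZMod 3 := if k = 0 then 1 else (-1) ^ (k + 1)

theorem sum_orthNorm_wronskian (i j N : ℕ) :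
    ∑ k ∈ Finset.range (N + 1), orthNorm k *
        (laurentCoeff (i + 1) k * laurentCoeff j k - laurentCoeff i k * laurentCoeff (j + 1) k) =
      (-1) ^ N * (laurentCoeff i (N + 1) * laurentCoeff j N -
        laurentCoeff i N * laurentCoeff j (N + 1)) := by
  induction N with
  | zero =>
    have hi := laurentCoeff_neg i 1
    have hj := laurentCoeff_neg j 1
    have h3 : (3 : ZMod 3) = 0 := rfl
    simp only [Nat.cast_one] at hi hj
    simp [orthNorm, laurentCoeff_succ, hi, hj]
    linear_combination (laurentCoeff i 0 * laurentCoeff j 1 -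
      laurentCoeff i 1 * laurentCoeff j 0) * h3
  | succ N ih =>
    rw [Finset.sum_range_succ, ih]
    simp only [orthNorm, laurentCoeff_succ, Nat.succ_ne_zero, if_false]
    push_cast
    rw [show (N : ℤ) + 1 - 1 = N by ring]
    ring

theorem sum_orthNorm_eq (i j M : ℕ) (h : i + j < M) :
    ∑ k ∈ Finset.range M, orthNorm k * (laurentCoeff i k * laurentCoeff j k) =
      laurentCoeff (i + j) 0 := by
  induction i generalizing j with
  | zero =>
    rw [Finset.sum_eq_single_of_mem 0 (by simp; omega)]
    · simp [orthNorm, laurentCoeff]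
    · intro k _ hk
      simp [laurentCoeff, hk]
  | succ i ih =>
    rw [show i + 1 + j = i + (j + 1) by ring, ← ih (j + 1) (by omega), ← sub_eq_zero,
      ← Finset.sum_sub_distrib]
    obtain ⟨N, rfl⟩ : ∃ N, M = N + 1 := ⟨M - 1, by omega⟩
    simp only [← mul_sub]
    rw [sum_orthNorm_wronskian, laurentCoeff_of_lt i (N + 1) (by omega),
      laurentCoeff_of_lt j (N + 1) (by omega)]
    ring

theorem sum_orthNorm_eq_of_lt (i j n : ℕ) (h : i < n) :
    ∑ k ∈ Finset.range n, orthNorm k * (laurentCoeff i k * laurentCoeff j k) =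
      laurentCoeff (i + j) 0 := by
  rw [← sum_orthNorm_eq i j (n + j) (by omega)]
  refine Finset.sum_subset (Finset.range_mono (by omega)) fun k _ hk => ?_
  rw [Finset.mem_range, not_lt] at hk
  rw [laurentCoeff_of_lt i k (by omega)]
  ring

theorem det_laurentCoeff_hankel (n : ℕ) :
    (Matrix.of fun i j : Fin n => laurentCoeff (i.1 + j.1) 0).det =
      ∏ k ∈ Finset.range n, orthNorm k := by
  set L : Matrix (Fin n) (Fin n) (ZMod 3) := Matrix.of fun i k => laurentCoeff i.1 k.1
  have hL : L.det = 1 := by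
    rw [Matrix.det_of_isLowerTriangular L fun i j hij => laurentCoeff_of_lt _ _ (by simpa using hij)]
    exact Finset.prod_eq_one fun i _ => laurentCoeff_self i
  have hfactor : (Matrix.of fun i j : Fin n => laurentCoeff (i.1 + j.1) 0) =
      L * Matrix.diagonal (fun k : Fin n => orthNorm k) * L.transpose := by
    ext i j
    rw [Matrix.mul_apply, Matrix.of_apply, ← sum_orthNorm_eq_of_lt i j n i.2,
      Finset.sum_range]
    refine Finset.sum_congr rfl fun k _ => ?_
    rw [Matrix.mul_diagonal, Matrix.transpose_apply]
    simp only [L, Matrix.of_apply]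
    ring
  rw [hfactor, Matrix.det_mul, Matrix.det_mul, Matrix.det_transpose, hL, Matrix.det_diagonal,
    Finset.prod_range]
  ring

theorem prod_orthNorm (m : ℕ) : ∏ k ∈ Finset.range (4 * m + 1), orthNorm k = 1 := by
  induction m with
  | zero => rfl
  | succ m ih =>
    rw [show 4 * (m + 1) + 1 = 4 * m + 1 + 1 + 1 + 1 + 1 by ring]
    simp only [Finset.prod_range_succ _ (_ + 1), ih]
    simp [orthNorm, pow_succ, pow_mul]

/-- Congruences modulo 3 for the Hankel determinants of the coefficient
sequence of `F₃`. -/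
theorem F3_hankel_mod3 (f : ℕ → ℤ)
    (h0 : f 0 = 1)
    (hf : ∀ n : ℕ, f (3 * n) = f n ∧ f (3 * n + 1) = - f n ∧ f (3 * n + 2) = - f n) :
    ∀ n : ℕ, 0 < n →
      ((n % 4 = 1 ∨ n % 4 = 2) → hankel f n ≡ 1 [ZMOD 3]) ∧
      ((n % 4 = 3 ∨ n % 4 = 0) → hankel f n ≡ 2 [ZMOD 3]) := by
  intro n hn
  have hdet : ((hankel f n : ℤ) : ZMod 3) = ∏ k ∈ Finset.range n, orthNorm k := by
    rw [← det_laurentCoeff_hankel, hankel, Int.cast_det]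
    congr 1
    ext i j
    simp [laurentCoeff_zero_eq f h0 hf]
  have htwo : (2 : ZMod 3) = -1 := rfl
  obtain ⟨m, hm⟩ : ∃ m, n = 4 * m + 1 ∨ n = 4 * m + 1 + 1 ∨ n = 4 * m + 1 + 1 + 1 ∨
      n = 4 * m + 1 + 1 + 1 + 1 := ⟨(n - 1) / 4, by omega⟩
  have hstep (k : ℕ) :
      ∏ i ∈ Finset.range (k + 1 + 1), orthNorm i =
        (∏ i ∈ Finset.range (k + 1), orthNorm i) * (-1) ^ k := by
    rw [Finset.prod_range_succ]
    simp [orthNorm, pow_succ]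
  refine ⟨fun h => (ZMod.intCast_eq_intCast_iff _ _ 3).1 ?_,
    fun h => (ZMod.intCast_eq_intCast_iff _ _ 3).1 ?_⟩ <;> rw [hdet] <;>
    rcases hm with rfl | rfl | rfl | rfl <;> first
      | omega
      | simp [hstep, prod_orthNorm, pow_succ, pow_mul, htwo]
end

section
/- For the sets J and K associated with d = 3 and v = (1,−1,−1), the following congruences hold modulo 2 for every n ≥ 1: U_{3n} ≡ X_n; V_{3n} ≡ X_n + Y_n; U_{3n+1} ≡ Z_{n+1}Y_n; V_{3n+1} ≡ Z_{n+1}X_n; U_{3n+2} ≡ Z_{n+1}Y_{n+1}; V_{3n+2} ≡ Z_{n+1}X_{n+1}; W_{3n} ≡ Z_n(X_n + X_nY_n + Y_n); W_{3n+1} ≡ Z_{n+1}(X_n + X_nY_n + Y_n); W_{3n+2} ≡ Z_{n+1}. -/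
/-- `J` for `d = 3`, `v = (1,−1,−1)`:
`{(3n+1)·3^{2k} − 1} ∪ {(3n+2)·3^{2k+1} − 1}`. -/
def J3 : Set ℕ :=
  {t | ∃ n k : ℕ, t + 1 = (3 * n + 1) * 3 ^ (2 * k)} ∪
  {t | ∃ n k : ℕ, t + 1 = (3 * n + 2) * 3 ^ (2 * k + 1)}

/-- `K` for `d = 3`, `v = (1,−1,−1)`:
`{(3n+2)·3^{2k} − 1} ∪ {(3n+1)·3^{2k+1} − 1}`. -/
def K3 : Set ℕ :=
  {t | ∃ n k : ℕ, t + 1 = (3 * n + 2) * 3 ^ (2 * k)} ∪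
  {t | ∃ n k : ℕ, t + 1 = (3 * n + 1) * 3 ^ (2 * k + 1)}

/-- The number of permutations `σ` of `{0,…,m−1}` with `i + σ(i) ∈ S` for all
`i ≠ l`. -/
noncomputable def permCount (S : Set ℕ) (m l : ℕ) : ℕ :=
  Nat.card {σ : Equiv.Perm (Fin m) //
    ∀ i : Fin m, (i : ℕ) ≠ l → ((i : ℕ) + ((σ i : Fin m) : ℕ)) ∈ S}

noncomputable def X (n : ℕ) : ℕ := ∑ i ∈ Finset.range n, permCount J3 n i
noncomputable def Y (n : ℕ) : ℕ := permCount J3 n n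
noncomputable def Z (n : ℕ) : ℕ := permCount J3 n (n - 1)
noncomputable def U (n : ℕ) : ℕ := ∑ i ∈ Finset.range n, permCount K3 n i
noncomputable def V (n : ℕ) : ℕ := permCount K3 n n
noncomputable def W (n : ℕ) : ℕ := permCount K3 n (n - 1)


namespace HankelParity

open Finset Matrix

/-- The `i`-th entry of the product of the Hankel matrix `c (i + j)` with `n` columns and `x`. -/
def hankelMul (c : ℕ → ZMod 2) (n : ℕ) (x : ℕ → ZMod 2) (i : ℕ) : ZMod 2 :=
  ∑ j ∈ range n, c (i + j) * x j

def total (n : ℕ) (x : ℕ → ZMod 2) : ZMod 2 := ∑ j ∈ range n, x j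

/-- The `n × n` Hankel matrix of `c` with row `l` replaced by ones (unchanged if `n ≤ l`). -/
def onesRow (c : ℕ → ZMod 2) (n l : ℕ) : Matrix (Fin n) (Fin n) (ZMod 2) :=
  of fun i j => if (i : ℕ) = l then 1 else c (i + j)

def onesRowDet (c : ℕ → ZMod 2) (n l : ℕ) : ZMod 2 := (onesRow c n l).det

def onesRowDetSum (c : ℕ → ZMod 2) (n : ℕ) : ZMod 2 := ∑ l ∈ range n, onesRowDet c n l

theorem cast_permCount (S : Set ℕ) (m l : ℕ) :
    (permCount S m l : ZMod 2) = onesRowDet (S.indicator 1) m l := by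
  classical
  rw [onesRowDet, ← det_transpose, det_apply, permCount, Nat.card_eq_fintype_card,
    Fintype.card_subtype, card_filter, Nat.cast_sum]
  refine sum_congr rfl fun σ _ => ?_
  have hs : ∀ t : ZMod 2, (Equiv.Perm.sign σ) • t = t := by
    rcases Int.units_eq_one_or (Equiv.Perm.sign σ) with h | h <;> rw [h] <;> decide
  rw [hs]
  simp only [transpose_apply, onesRow, of_apply]
  have : ∀ i : Fin m, (if (i : ℕ) = l then (1 : ZMod 2)
      else S.indicator 1 ((i : ℕ) + (σ i : ℕ))) =
      if ((i : ℕ) ≠ l → (i : ℕ) + (σ i : ℕ) ∈ S) then 1 else 0 := by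
    intro i
    by_cases h : (i : ℕ) = l <;> simp [h, Set.indicator_apply]
  simp only [this, prod_ite_zero, prod_const_one, mem_univ, true_imp_iff]
  split_ifs <;> simp

theorem cast_sum_permCount (S : Set ℕ) (m : ℕ) :
    ((∑ l ∈ range m, permCount S m l : ℕ) : ZMod 2) = onesRowDetSum (S.indicator 1) m := by
  simp only [Nat.cast_sum, cast_permCount, onesRowDetSum]

theorem det_ne_zero_iff (n : ℕ) (f : ℕ → ℕ → ZMod 2) :
    (of fun i j : Fin n => f i j).det ≠ 0 ↔
      ∀ x : ℕ → ZMod 2, (∀ i < n, ∑ j ∈ range n, f i j * x j = 0) → ∀ j < n, x j = 0 := by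
  rw [ne_eq, ← exists_mulVec_eq_zero_iff, not_exists]
  constructor
  · intro h x hx j hj
    by_contra hne
    refine h (fun i => x i) ⟨fun h0 => hne (congrFun h0 ⟨j, hj⟩), ?_⟩
    ext i
    simpa [mulVec, dotProduct, sum_range] using hx i i.2
  · rintro h v ⟨hv, hv0⟩
    refine hv (funext fun i => ?_)
    have := h (fun i => if hi : i < n then v ⟨i, hi⟩ else 0) (fun i hi => ?_) i i.2
    · simpa using this
    · simpa [mulVec, dotProduct, sum_range] using congrFun hv0 ⟨i, hi⟩

theorem exists_solution_of_det_ne_zero (n : ℕ) (f : ℕ → ℕ → ZMod 2)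
    (h : (of fun i j : Fin n => f i j).det ≠ 0) (g : ℕ → ZMod 2) :
    ∃ x : ℕ → ZMod 2, ∀ i < n, ∑ j ∈ range n, f i j * x j = g i := by
  set M : Matrix (Fin n) (Fin n) (ZMod 2) := of fun i j => f i j with hM
  have hu : IsUnit M.det := isUnit_iff_ne_zero.2 h
  refine ⟨fun i => if hi : i < n then (M⁻¹ *ᵥ fun i : Fin n => g i) ⟨i, hi⟩ else 0,
    fun i hi => ?_⟩
  have : M *ᵥ (M⁻¹ *ᵥ fun i : Fin n => g i) = fun i : Fin n => g i := by
    rw [mulVec_mulVec, mul_nonsing_inv _ hu, one_mulVec]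
  have := congrFun this ⟨i, hi⟩
  rw [mulVec, dotProduct] at this
  simpa [sum_range, hM] using this

/-- Symmetry of the pairing defined by a Hankel matrix. -/
theorem sum_mul_hankelMul (c : ℕ → ZMod 2) (m n : ℕ) (w x : ℕ → ZMod 2) :
    ∑ i ∈ range m, w i * hankelMul c n x i = ∑ j ∈ range n, x j * hankelMul c m w j := by
  simp only [hankelMul, mul_sum]
  rw [sum_comm]
  refine sum_congr rfl fun j _ => sum_congr rfl fun i _ => ?_
  rw [add_comm i j]; ring

theorem total_eq_zero {n : ℕ} {x : ℕ → ZMod 2} (h : ∀ j < n, x j = 0) : total n x = 0 :=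
  sum_eq_zero fun j hj => h j (mem_range.1 hj)

theorem sum_mul_const {n : ℕ} (w g : ℕ → ZMod 2) {k : ZMod 2} (h : ∀ i < n, g i = k) :
    ∑ i ∈ range n, w i * g i = total n w * k := by
  rw [total, sum_mul]
  exact sum_congr rfl fun i hi => by rw [h i (mem_range.1 hi)]

section Square

variable (c : ℕ → ZMod 2) (n : ℕ)

theorem onesRow_self : onesRow c n n = of fun i j : Fin n => c (i + j) := by
  ext i j
  simp [onesRow, i.2.ne]

theorem onesRow_eq_updateRow (l : Fin n) :
    onesRow c n l = (onesRow c n n).updateRow l 1 := by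
  ext i j
  by_cases h : i = l
  · simp [onesRow, h]
  · simp [onesRow, Fin.val_inj, h, i.2.ne]

theorem onesRowDetSum_eq :
    onesRowDetSum c n = ∑ l : Fin n, ((onesRow c n n).updateRow l 1).det := by
  simp only [onesRowDetSum, sum_range, onesRowDet, onesRow_eq_updateRow]

theorem onesRowDet_self_ne_zero_iff :
    onesRowDet c n n ≠ 0 ↔
      ∀ x, (∀ i < n, hankelMul c n x i = 0) → ∀ j < n, x j = 0 := by
  rw [onesRowDet, onesRow_self]
  exact det_ne_zero_iff n fun i j => c (i + j)

theorem exists_cramer_solution :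
    ∃ w, (∀ i < n, hankelMul c n w i = onesRowDet c n n) ∧ total n w = onesRowDetSum c n := by
  have hT : (onesRow c n n)ᵀ = onesRow c n n := by
    rw [onesRow_self]; ext i j; simp [add_comm]
  refine ⟨fun i => if hi : i < n then cramer (onesRow c n n) 1 ⟨i, hi⟩ else 0,
    fun i hi => ?_, ?_⟩
  · have := congrFun (mulVec_cramer (onesRow c n n) 1) ⟨i, hi⟩
    rw [mulVec, dotProduct] at this
    rw [onesRowDet]
    simpa [hankelMul, sum_range, onesRow, Fin.is_lt, ne_of_lt] using this
  · rw [onesRowDetSum_eq, total, sum_range]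
    refine sum_congr rfl fun i _ => ?_
    rw [← cramer_transpose_apply, hT]
    simp

theorem det_mul_total {x : ℕ → ZMod 2} {k : ZMod 2} (h : ∀ i < n, hankelMul c n x i = k) :
    onesRowDet c n n * total n x = onesRowDetSum c n * k := by
  obtain ⟨w, hw, hs⟩ := exists_cramer_solution c n
  rw [← hs, ← sum_mul_const w _ h, sum_mul_hankelMul, sum_mul_const x _ hw, mul_comm]

/-- Adding the all-ones row to the rows indexed by `s`. -/
theorem det_add_ones_on {m : Type*} [Fintype m] [DecidableEq m] {R : Type*} [CommRing R]
    (A : Matrix m m R) (s : Finset m) :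
    (of fun i j => A i j + if i ∈ s then 1 else 0).det =
      A.det + ∑ i ∈ s, (A.updateRow i 1).det := by
  induction s using Finset.induction_on with
  | empty =>
    simp only [notMem_empty, if_false, add_zero, sum_empty]
    rfl
  | insert k s hk ih =>
    set B : Matrix m m R := of fun i j => A i j + if i ∈ s then 1 else 0 with hB
    have h1 : (of fun i j => A i j + if i ∈ insert k s then 1 else 0) =
        B.updateRow k (B k + 1) := by
      ext i j
      by_cases h : i = k
      · subst h; simp [hB, hk]
      · simp [hB, h]
    have h2 : (B.updateRow k 1).det = (A.updateRow k 1).det := by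
      refine det_eq_of_forall_row_eq_smul_add_const (fun i => if i ∈ s then 1 else 0) k
        (by simp [hk]) fun i j => ?_
      by_cases h : i = k
      · subst h; simp [hk]
      · simp [hB, updateRow_ne h]
    rw [h1, det_updateRow_add, updateRow_eq_self, h2, ih, sum_insert hk]
    ring

theorem add_ones_ne_zero_iff :
    onesRowDetSum c n + onesRowDet c n n ≠ 0 ↔
      ∀ x, (∀ i < n, hankelMul c n x i = total n x) → ∀ j < n, x j = 0 := by
  have hd := det_add_ones_on (onesRow c n n) univ
  rw [← onesRowDetSum_eq, add_comm (det _)] at hd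
  simp only [mem_univ, if_true, onesRow_self, of_apply] at hd
  have hY : onesRowDet c n n = (of fun i j : Fin n => c (i + j)).det := by
    rw [onesRowDet, onesRow_self]
  rw [hY, ← hd]
  refine (det_ne_zero_iff n fun i j => c (i + j) + 1).trans ?_
  simp only [add_mul, one_mul, sum_add_distrib, hankelMul, total, CharTwo.add_eq_zero]

/-- The Hankel matrix stacked on a row of ones is injective iff one of the two determinants is
nonzero. -/
theorem injective_iff :
    (∀ x, (∀ i < n, hankelMul c n x i = 0) → total n x = 0 → ∀ j < n, x j = 0) ↔
      onesRowDetSum c n ≠ 0 ∨ onesRowDet c n n ≠ 0 := by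
  constructor
  · intro h
    by_contra! hXY
    obtain ⟨hX, hY⟩ := hXY
    have hV := (add_ones_ne_zero_iff c n).not_right.1 (by simp [hX, hY])
    have hY' := (onesRowDet_self_ne_zero_iff c n).not_right.1 (by simp [hY])
    push Not at hV hY'
    obtain ⟨v, hv, j, hj, hvj⟩ := hV
    obtain ⟨w, hw, i, hi, hwi⟩ := hY'
    have hp := sum_mul_hankelMul c n n w v
    rw [sum_mul_const w _ hv, sum_mul_const v _ hw, mul_zero, mul_eq_zero] at hp
    rcases hp with h0 | h0
    · exact hwi (h w hw h0 i hi)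
    · exact hvj (h v (by simpa [h0] using hv) h0 j hj)
  · intro h x hx h0
    by_cases hY : onesRowDet c n n = 0
    · refine (add_ones_ne_zero_iff c n).1 ?_ x (by simpa [h0] using hx)
      simpa [hY] using h
    · exact (onesRowDet_self_ne_zero_iff c n).1 hY x hx

theorem onesRowDetSum_ne_zero_iff :
    onesRowDetSum c n ≠ 0 ↔
      ∀ x k, (∀ i < n, hankelMul c n x i = k) → total n x = 0 → k = 0 ∧ ∀ j < n, x j = 0 := by
  constructor
  · intro hX x k hx h0
    have hk : k = 0 := by
      have := det_mul_total c n hx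
      rw [h0, mul_zero, eq_comm, mul_eq_zero] at this
      exact this.resolve_left hX
    subst hk
    exact ⟨rfl, (injective_iff c n).2 (Or.inl hX) x hx h0⟩
  · intro h hX
    obtain ⟨w, hw, hs⟩ := exists_cramer_solution c n
    have hY := (h w _ hw (hs.trans hX)).1
    have := (injective_iff c n).1 fun x hx h0 => (h x 0 hx h0).2
    simp [hX, hY] at this

theorem onesRowDet_last_eq :
    onesRowDet c (n + 1) n =
      (of fun i j : Fin (n + 1) => if (i : ℕ) = n then 1 else c (i + j)).det := rfl

theorem onesRowDet_last_ne_zero_iff :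
    onesRowDet c (n + 1) n ≠ 0 ↔
      ∀ x, (∀ i < n, hankelMul c (n + 1) x i = 0) → total (n + 1) x = 0 →
        ∀ j < n + 1, x j = 0 := by
  rw [onesRowDet_last_eq,
    det_ne_zero_iff (n + 1) fun i j => if i = n then 1 else c (i + j)]
  refine forall_congr' fun x => ?_
  rw [← and_imp]
  refine imp_congr_left ⟨fun h => ⟨fun i hi => ?_, ?_⟩, fun h i hi => ?_⟩
  · simpa [hi.ne, hankelMul] using h i (by omega)
  · simpa [total] using h n (by omega)
  · by_cases hin : i = n
    · simpa [hin, total] using h.2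
    · simpa [hin, hankelMul] using h.1 i (by omega)

theorem exists_solution_of_last_ne_zero {c : ℕ → ZMod 2} {n : ℕ}
    (h : onesRowDet c (n + 1) n ≠ 0) (g : ℕ → ZMod 2) (e : ZMod 2) :
    ∃ x, (∀ i < n, hankelMul c (n + 1) x i = g i) ∧ total (n + 1) x = e := by
  obtain ⟨x, hx⟩ := exists_solution_of_det_ne_zero (n + 1)
    (fun i j => if i = n then 1 else c (i + j)) h fun i => if i = n then e else g i
  refine ⟨x, fun i hi => ?_, ?_⟩
  · simpa [hi.ne, hankelMul] using hx i (by omega)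
  · simpa [total] using hx n (by omega)

theorem eq_zero_of_last_ne_zero {c : ℕ → ZMod 2} {n : ℕ} (h : onesRowDet c (n + 1) n ≠ 0)
    {x : ℕ → ZMod 2} {k : ZMod 2} (hx : ∀ i < n + 1, hankelMul c n x i = k) :
    k = 0 ∧ ∀ j < n, x j = 0 := by
  have key : ∀ z, total (n + 1) z * k = ∑ j ∈ range n, x j * hankelMul c (n + 1) z j :=
    fun z => by rw [← sum_mul_const z _ hx, sum_mul_hankelMul]
  have hk : k = 0 := by
    obtain ⟨z, hz, h1⟩ := exists_solution_of_last_ne_zero h (fun _ => 0) 1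
    have := key z
    rwa [h1, one_mul, sum_mul_const x _ hz, mul_zero] at this
  refine ⟨hk, fun j hj => ?_⟩
  obtain ⟨z, hz, -⟩ := exists_solution_of_last_ne_zero h (fun i => if i = j then 1 else 0) 0
  have := key z
  rw [hk, mul_zero, sum_congr rfl fun i hi => by rw [hz i (mem_range.1 hi)]] at this
  simpa [hj] using this.symm

end Square

section BlockSystem

variable (a : ℕ → ZMod 2)

/-- The linear system obtained from the Hankel matrix of a sequence with trisections `0, 1, a`
by sorting rows and columns according to their residue modulo `3`. -/
def BlockSystem (nx ny nz mx my mz : ℕ) (e : ZMod 2) (x y z : ℕ → ZMod 2) : Prop :=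
  (∀ p < mx, hankelMul a nz z p = total ny y + e) ∧
  (∀ p < my, hankelMul a ny y p = total nx x + e) ∧
  (∀ p < mz, hankelMul a nx x p = total nz z + e)

def AllZero (nx ny nz : ℕ) (x y z : ℕ → ZMod 2) : Prop :=
  (∀ j < nx, x j = 0) ∧ (∀ j < ny, y j = 0) ∧ (∀ j < nz, z j = 0)

theorem square_system_iff (n : ℕ) :
    (∀ x y z, BlockSystem a n n n n n n 0 x y z → AllZero n n n x y z) ↔
      onesRowDetSum a n + onesRowDet a n n ≠ 0 := by
  constructor
  · intro h
    refine (add_ones_ne_zero_iff a n).2 fun x hx => ?_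
    exact (h x x x ⟨by simpa using hx, by simpa using hx, by simpa using hx⟩).1
  · rintro h x y z ⟨h1, h2, h3⟩
    have r1 := det_mul_total a n h1
    have r2 := det_mul_total a n h2
    have r3 := det_mul_total a n h3
    have inj := (injective_iff a n).2 (by by_contra! h0; simp [h0.1, h0.2] at h)
    have key : ∀ p q s t u : ZMod 2, p + q ≠ 0 → q * u = p * (t + 0) → q * t = p * (s + 0) →
        q * s = p * (u + 0) → s = 0 ∧ t = 0 ∧ u = 0 := by decide
    obtain ⟨hs, ht, hu⟩ := key _ _ _ _ _ h r1 r2 r3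
    simp only [hs, ht, hu, add_zero] at h1 h2 h3
    exact ⟨inj x h3 hs, inj y h2 ht, inj z h1 hu⟩

theorem square_bordered_system_iff (n : ℕ) :
    (∀ x y z e, BlockSystem a n n n n n n e x y z → total n x + total n y + total n z = 0 →
      e = 0 ∧ AllZero n n n x y z) ↔ onesRowDetSum a n ≠ 0 := by
  constructor
  · intro h
    refine (onesRowDetSum_ne_zero_iff a n).2 fun x k hx h0 => ?_
    obtain ⟨he, hx, -⟩ := h x x x k ⟨by simpa [h0] using hx, by simpa [h0] using hx,
      by simpa [h0] using hx⟩ (by simp [h0])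
    exact ⟨he, hx⟩
  · rintro h x y z e ⟨h1, h2, h3⟩ h0
    have r1 := det_mul_total a n h1
    have r2 := det_mul_total a n h2
    have r3 := det_mul_total a n h3
    have inj := (injective_iff a n).2 (Or.inl h)
    have key : ∀ p q s t u e : ZMod 2, p ≠ 0 → q * u = p * (t + e) → q * t = p * (s + e) →
        q * s = p * (u + e) → s + t + u = 0 → e = 0 ∧ s = 0 ∧ t = 0 ∧ u = 0 := by decide
    obtain ⟨he, hs, ht, hu⟩ := key _ _ _ _ _ _ h r1 r2 r3 h0
    simp only [hs, ht, hu, he, add_zero] at h1 h2 h3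
    exact ⟨he, inj x h3 hs, inj y h2 ht, inj z h1 hu⟩

theorem wide_system_iff (n k : ℕ) :
    (∀ x y z, BlockSystem a (n + 1) k n (n + 1) k n 0 x y z → AllZero (n + 1) k n x y z) ↔
      onesRowDet a (n + 1) n ≠ 0 ∧ onesRowDetSum a k ≠ 0 := by
  constructor
  · intro h
    have hZ : onesRowDet a (n + 1) n ≠ 0 := by
      refine (onesRowDet_last_ne_zero_iff a n).2 fun x hx h0 => ?_
      refine (h x 0 0 ⟨?_, ?_, ?_⟩).1 <;> simp_all [hankelMul, total]
    refine ⟨hZ, (onesRowDetSum_ne_zero_iff a k).2 fun y e hy h0 => ?_⟩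
    obtain ⟨x, hx, hxe⟩ := exists_solution_of_last_ne_zero hZ 0 e
    obtain ⟨hx0, hy0, -⟩ := h x y 0 ⟨by simp [hankelMul, h0], by simpa [hxe] using hy,
      fun p hp => by simp [hx p hp, total]⟩
    exact ⟨hxe.symm.trans (total_eq_zero hx0), hy0⟩
  · rintro ⟨hZ, hX⟩ x y z ⟨h1, h2, h3⟩
    obtain ⟨hy0, hz⟩ := eq_zero_of_last_ne_zero hZ h1
    rw [add_zero] at hy0
    obtain ⟨hx0, hy⟩ := (onesRowDetSum_ne_zero_iff a k).1 hX y _ h2 hy0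
    rw [add_zero] at hx0
    refine ⟨(onesRowDet_last_ne_zero_iff a n).1 hZ x (fun p hp => ?_) hx0, hy, hz⟩
    rw [h3 p hp, total_eq_zero hz, add_zero]

theorem wide_bordered_system_iff (n k : ℕ) :
    (∀ x y z e, BlockSystem a (n + 1) k n (n + 1) k n e x y z →
      total (n + 1) x + total k y + total n z = 0 → e = 0 ∧ AllZero (n + 1) k n x y z) ↔
      onesRowDet a (n + 1) n ≠ 0 ∧ onesRowDet a k k ≠ 0 := by
  constructor
  · intro h
    have hZ : onesRowDet a (n + 1) n ≠ 0 := by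
      refine (onesRowDet_last_ne_zero_iff a n).2 fun x hx h0 => ?_
      refine (h x 0 0 0 ⟨?_, ?_, ?_⟩ ?_).2.1 <;> simp_all [hankelMul, total]
    refine ⟨hZ, (onesRowDet_self_ne_zero_iff a k).2 fun y hy => ?_⟩
    obtain ⟨x, hx, hxe⟩ :=
      exists_solution_of_last_ne_zero hZ (fun _ => total k y) (total k y)
    have hz : total n 0 = 0 := total_eq_zero fun _ _ => rfl
    refine (h x y 0 (total k y) ⟨?_, ?_, ?_⟩ ?_).2.2.1
    · simp [hankelMul, CharTwo.add_self_eq_zero]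
    · simpa [hxe, CharTwo.add_self_eq_zero] using hy
    · simpa [hz] using hx
    · simp [hz, hxe, CharTwo.add_self_eq_zero]
  · rintro ⟨hZ, hY⟩ x y z e ⟨h1, h2, h3⟩ h0
    obtain ⟨hy0, hz⟩ := eq_zero_of_last_ne_zero hZ h1
    have hz0 := total_eq_zero hz
    rw [hz0, add_zero] at h0
    have key : ∀ s t e : ZMod 2, t + e = 0 → s + t = 0 → s = e ∧ t = e := by decide
    obtain ⟨hs, ht⟩ := key _ _ _ hy0 h0
    have hy := (onesRowDet_self_ne_zero_iff a k).1 hY y fun p hp => by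
      rw [h2 p hp, hs, CharTwo.add_self_eq_zero]
    have he : e = 0 := ht.symm.trans (total_eq_zero hy)
    subst he
    exact ⟨rfl, (onesRowDet_last_ne_zero_iff a n).1 hZ x
      (fun p hp => by rw [h3 p hp, hz0, add_zero]) hs, hy, hz⟩

theorem short_system_iff (n k : ℕ) :
    (∀ x y z, BlockSystem a (n + 1) k k k k n 0 x y z →
      total (n + 1) x + total k y + total k z = 0 → AllZero (n + 1) k k x y z) ↔
      onesRowDet a (n + 1) n ≠ 0 ∧ (onesRowDetSum a k ≠ 0 ∨ onesRowDet a k k ≠ 0) := by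
  constructor
  · intro h
    constructor
    · refine (onesRowDet_last_ne_zero_iff a n).2 fun x hx h0 => ?_
      refine (h x 0 0 ⟨?_, ?_, ?_⟩ ?_).1 <;> simp_all [hankelMul, total]
    · refine (injective_iff a k).1 fun z hz h0 => ?_
      refine (h 0 0 z ⟨?_, ?_, ?_⟩ ?_).2.2 <;> simp_all [hankelMul, total]
  · rintro ⟨hZ, hXY⟩ x y z ⟨h1, h2, h3⟩ h0
    have r1 := det_mul_total a k h1
    have r2 := det_mul_total a k h2
    have inj := (injective_iff a k).2 hXY
    have key : ∀ p q s t u : ZMod 2, p ≠ 0 ∨ q ≠ 0 → q * u = p * (t + 0) →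
        q * t = p * (s + 0) → s + t + u = 0 → s = 0 ∧ t = 0 ∧ u = 0 := by decide
    obtain ⟨hs, ht, hu⟩ := key _ _ _ _ _ hXY r1 r2 h0
    simp only [hs, ht, hu, add_zero] at h1 h2 h3
    exact ⟨(onesRowDet_last_ne_zero_iff a n).1 hZ x h3 hs, inj y h2 ht, inj z h1 hu⟩

theorem wide_short_system_iff (n : ℕ) :
    (∀ x y z, BlockSystem a (n + 1) (n + 1) n (n + 1) n n 0 x y z →
      total (n + 1) x + total (n + 1) y + total n z = 0 →
        AllZero (n + 1) (n + 1) n x y z) ↔ onesRowDet a (n + 1) n ≠ 0 := by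
  constructor
  · intro h
    refine (onesRowDet_last_ne_zero_iff a n).2 fun x hx h0 => ?_
    refine (h x 0 0 ⟨?_, ?_, ?_⟩ ?_).1 <;> simp_all [hankelMul, total]
  · rintro hZ x y z ⟨h1, h2, h3⟩ h0
    have inj := (onesRowDet_last_ne_zero_iff a n).1 hZ
    obtain ⟨hy0, hz⟩ := eq_zero_of_last_ne_zero hZ h1
    rw [add_zero] at hy0
    have hz0 := total_eq_zero hz
    rw [hy0, hz0, add_zero, add_zero] at h0
    simp only [h0, hz0, add_zero] at h2 h3
    exact ⟨inj x h3 h0, inj y h2 hy0, hz⟩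

end BlockSystem

section Trisection

variable {a b : ℕ → ZMod 2}

theorem sum_range_trisect (N : ℕ) (f : ℕ → ZMod 2) :
    ∑ j ∈ range N, f j = ∑ q ∈ range ((N + 2) / 3), f (3 * q) +
      ∑ q ∈ range ((N + 1) / 3), f (3 * q + 1) + ∑ q ∈ range (N / 3), f (3 * q + 2) := by
  induction N with
  | zero => simp
  | succ N ih =>
    rw [sum_range_succ, ih]
    obtain ⟨k, rfl | rfl | rfl⟩ : ∃ k, N = 3 * k ∨ N = 3 * k + 1 ∨ N = 3 * k + 2 :=
      ⟨N / 3, by omega⟩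
    · rw [show (3 * k + 1 + 2) / 3 = k + 1 by omega, show (3 * k + 1 + 1) / 3 = k by omega,
        show (3 * k + 1) / 3 = k by omega,
        show 3 * k / 3 = k by omega, sum_range_succ]
      ring
    · rw [show (3 * k + 1 + 1 + 2) / 3 = k + 1 by omega,
        show (3 * k + 1 + 1 + 1) / 3 = k + 1 by omega,
        show (3 * k + 1 + 1) / 3 = k by omega, show (3 * k + 1) / 3 = k by omega,
        sum_range_succ _ k, sum_range_succ _ k]
      ring
    · rw [show (3 * k + 2 + 1 + 2) / 3 = k + 1 by omega,
        show (3 * k + 2 + 1 + 1) / 3 = k + 1 by omega,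
        show (3 * k + 2 + 1) / 3 = k + 1 by omega, show (3 * k + 2) / 3 = k by omega,
        sum_range_succ _ k, sum_range_succ _ k, sum_range_succ (fun q => f (3 * q + 2)) k]
      ring

theorem forall_lt_trisect (R : ℕ) (P : ℕ → Prop) :
    (∀ i < R, P i) ↔ (∀ p < (R + 2) / 3, P (3 * p)) ∧ (∀ p < (R + 1) / 3, P (3 * p + 1)) ∧
      ∀ p < R / 3, P (3 * p + 2) := by
  refine ⟨fun h => ⟨fun p hp => h _ (by omega), fun p hp => h _ (by omega),
    fun p hp => h _ (by omega)⟩, fun ⟨h0, h1, h2⟩ i hi => ?_⟩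
  obtain ⟨k, rfl | rfl | rfl⟩ : ∃ k, i = 3 * k ∨ i = 3 * k + 1 ∨ i = 3 * k + 2 :=
    ⟨i / 3, by omega⟩
  · exact h0 k (by omega)
  · exact h1 k (by omega)
  · exact h2 k (by omega)

theorem forall_trisect (P : (ℕ → ZMod 2) → (ℕ → ZMod 2) → (ℕ → ZMod 2) → Prop) :
    (∀ v : ℕ → ZMod 2, P (fun q => v (3 * q)) (fun q => v (3 * q + 1))
      (fun q => v (3 * q + 2))) ↔ ∀ x y z, P x y z := by
  refine ⟨fun h x y z => ?_, fun h v => h _ _ _⟩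
  have := h fun j => if j % 3 = 0 then x (j / 3) else if j % 3 = 1 then y (j / 3) else z (j / 3)
  simpa [Nat.mul_add_mod, show ∀ q, (3 * q + 1) / 3 = q by omega,
    show ∀ q, (3 * q + 2) / 3 = q by omega] using this

theorem total_trisect (N : ℕ) (v : ℕ → ZMod 2) :
    total N v = total ((N + 2) / 3) (fun q => v (3 * q)) +
      total ((N + 1) / 3) (fun q => v (3 * q + 1)) + total (N / 3) (fun q => v (3 * q + 2)) :=
  sum_range_trisect N v

theorem allZero_trisect (N : ℕ) (v : ℕ → ZMod 2) :
    (∀ j < N, v j = 0) ↔ AllZero ((N + 2) / 3) ((N + 1) / 3) (N / 3) (fun q => v (3 * q))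
      (fun q => v (3 * q + 1)) (fun q => v (3 * q + 2)) :=
  forall_lt_trisect N fun j => v j = 0

variable (h0 : ∀ t, b (3 * t) = 0) (h1 : ∀ t, b (3 * t + 1) = 1)
  (h2 : ∀ t, b (3 * t + 2) = a t)

include h0 h1 h2

theorem hankelMul_trisect (N R : ℕ) (v : ℕ → ZMod 2) (e : ZMod 2) :
    (∀ i < R, hankelMul b N v i = e) ↔
      BlockSystem a ((N + 2) / 3) ((N + 1) / 3) (N / 3) ((R + 2) / 3) ((R + 1) / 3) (R / 3) e
        (fun q => v (3 * q)) (fun q => v (3 * q + 1)) (fun q => v (3 * q + 2)) := by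
  have key : ∀ s t e : ZMod 2, s + t = e ↔ t = s + e := by decide
  rw [forall_lt_trisect, BlockSystem]
  refine and_congr ?_ (and_congr ?_ ?_)
  all_goals
    refine forall_congr' fun p => imp_congr_right fun _ => ?_
    rw [← key, hankelMul, sum_range_trisect]
  · simp only [show ∀ q, 3 * p + 3 * q = 3 * (p + q) by intro; ring,
      show ∀ q, 3 * p + (3 * q + 1) = 3 * (p + q) + 1 by intro; ring,
      show ∀ q, 3 * p + (3 * q + 2) = 3 * (p + q) + 2 by intro; ring, h0, h1, h2]
    simp [hankelMul, total]
  · simp only [show ∀ q, 3 * p + 1 + 3 * q = 3 * (p + q) + 1 by intro; ring,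
      show ∀ q, 3 * p + 1 + (3 * q + 1) = 3 * (p + q) + 2 by intro; ring,
      show ∀ q, 3 * p + 1 + (3 * q + 2) = 3 * (p + q + 1) by intro; ring, h0, h1, h2]
    simp [hankelMul, total]
  · simp only [show ∀ q, 3 * p + 2 + 3 * q = 3 * (p + q) + 2 by intro; ring,
      show ∀ q, 3 * p + 2 + (3 * q + 1) = 3 * (p + q + 1) by intro; ring,
      show ∀ q, 3 * p + 2 + (3 * q + 2) = 3 * (p + q + 1) + 1 by intro; ring, h0, h1, h2]
    simp [hankelMul, total, add_comm]

theorem det_ne_zero_iff_blockSystem (N : ℕ) :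
    onesRowDet b N N ≠ 0 ↔ ∀ x y z,
      BlockSystem a ((N + 2) / 3) ((N + 1) / 3) (N / 3) ((N + 2) / 3) ((N + 1) / 3) (N / 3) 0
        x y z → AllZero ((N + 2) / 3) ((N + 1) / 3) (N / 3) x y z := by
  simp only [onesRowDet_self_ne_zero_iff, hankelMul_trisect h0 h1 h2,
    allZero_trisect N]
  exact forall_trisect fun x y z => BlockSystem a ((N + 2) / 3) ((N + 1) / 3) (N / 3)
    ((N + 2) / 3) ((N + 1) / 3) (N / 3) 0 x y z →
      AllZero ((N + 2) / 3) ((N + 1) / 3) (N / 3) x y z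

theorem detSum_ne_zero_iff_blockSystem (N : ℕ) :
    onesRowDetSum b N ≠ 0 ↔ ∀ x y z e,
      BlockSystem a ((N + 2) / 3) ((N + 1) / 3) (N / 3) ((N + 2) / 3) ((N + 1) / 3) (N / 3) e
        x y z → total ((N + 2) / 3) x + total ((N + 1) / 3) y + total (N / 3) z = 0 →
      e = 0 ∧ AllZero ((N + 2) / 3) ((N + 1) / 3) (N / 3) x y z := by
  simp only [onesRowDetSum_ne_zero_iff, hankelMul_trisect h0 h1 h2, total_trisect N,
    allZero_trisect N]
  exact forall_trisect fun x y z => ∀ e,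
    BlockSystem a ((N + 2) / 3) ((N + 1) / 3) (N / 3) ((N + 2) / 3) ((N + 1) / 3) (N / 3) e
      x y z → total ((N + 2) / 3) x + total ((N + 1) / 3) y + total (N / 3) z = 0 →
    e = 0 ∧ AllZero ((N + 2) / 3) ((N + 1) / 3) (N / 3) x y z

theorem last_ne_zero_iff_blockSystem (R : ℕ) :
    onesRowDet b (R + 1) R ≠ 0 ↔ ∀ x y z,
      BlockSystem a ((R + 1 + 2) / 3) ((R + 1 + 1) / 3) ((R + 1) / 3)
        ((R + 2) / 3) ((R + 1) / 3) (R / 3) 0 x y z →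
      total ((R + 1 + 2) / 3) x + total ((R + 1 + 1) / 3) y + total ((R + 1) / 3) z = 0 →
      AllZero ((R + 1 + 2) / 3) ((R + 1 + 1) / 3) ((R + 1) / 3) x y z := by
  simp only [onesRowDet_last_ne_zero_iff, hankelMul_trisect h0 h1 h2, total_trisect (R + 1),
    allZero_trisect (R + 1)]
  exact forall_trisect fun x y z => BlockSystem a ((R + 1 + 2) / 3) ((R + 1 + 1) / 3)
    ((R + 1) / 3) ((R + 2) / 3) ((R + 1) / 3) (R / 3) 0 x y z →
      total ((R + 1 + 2) / 3) x + total ((R + 1 + 1) / 3) y + total ((R + 1) / 3) z = 0 →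
      AllZero ((R + 1 + 2) / 3) ((R + 1 + 1) / 3) ((R + 1) / 3) x y z

end Trisection

section Sets

theorem indicator_K3_three_mul (t : ℕ) : K3.indicator (1 : ℕ → ZMod 2) (3 * t) = 0 := by
  refine Set.indicator_of_notMem ?_ _
  rintro (⟨n, k, h⟩ | ⟨n, k, h⟩)
  · cases k with
    | zero => omega
    | succ k => rw [show 2 * (k + 1) = 2 * k + 1 + 1 by ring, pow_succ, ← mul_assoc] at h; omega
  · rw [pow_succ, ← mul_assoc] at h; omega

theorem indicator_K3_three_mul_add_one (t : ℕ) :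
    K3.indicator (1 : ℕ → ZMod 2) (3 * t + 1) = 1 := by
  have h : 3 * t + 1 ∈ K3 := Or.inl ⟨t, 0, by ring⟩
  simp [h]

theorem three_mul_add_two_mem_K3 (t : ℕ) : 3 * t + 2 ∈ K3 ↔ t ∈ J3 := by
  constructor
  · rintro (⟨n, k, h⟩ | ⟨n, k, h⟩)
    · cases k with
      | zero => omega
      | succ k =>
        rw [show 2 * (k + 1) = 2 * k + 1 + 1 by ring, pow_succ, ← mul_assoc] at h
        exact Or.inr ⟨n, k, by omega⟩
    · rw [pow_succ, ← mul_assoc] at h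
      exact Or.inl ⟨n, k, by omega⟩
  · rintro (⟨n, k, h⟩ | ⟨n, k, h⟩)
    · exact Or.inr ⟨n, k, by rw [pow_succ, ← mul_assoc]; omega⟩
    · refine Or.inl ⟨n, k + 1, ?_⟩
      rw [show 2 * (k + 1) = 2 * k + 1 + 1 by ring, pow_succ, ← mul_assoc]
      omega

theorem indicator_K3_three_mul_add_two (t : ℕ) :
    K3.indicator (1 : ℕ → ZMod 2) (3 * t + 2) = J3.indicator 1 t := by
  classical
  simp [Set.indicator_apply, three_mul_add_two_mem_K3]

theorem modEq_two_iff (p q : ℕ) :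
    p ≡ q [MOD 2] ↔ ((p : ZMod 2) ≠ 0 ↔ (q : ZMod 2) ≠ 0) := by
  have key : ∀ s t : ZMod 2, s = t ↔ (s ≠ 0 ↔ t ≠ 0) := by decide
  rw [← ZMod.natCast_eq_natCast_iff, key]

end Sets

end HankelParity

/-- Recurrences mod 2 expressing `U, V, W` in terms of `X, Y, Z`. -/
theorem F3_recurrences_UVW :
    ∀ n : ℕ, 1 ≤ n →
      U (3 * n) ≡ X n [MOD 2] ∧
      V (3 * n) ≡ X n + Y n [MOD 2] ∧
      U (3 * n + 1) ≡ Z (n + 1) * Y n [MOD 2] ∧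
      V (3 * n + 1) ≡ Z (n + 1) * X n [MOD 2] ∧
      U (3 * n + 2) ≡ Z (n + 1) * Y (n + 1) [MOD 2] ∧
      V (3 * n + 2) ≡ Z (n + 1) * X (n + 1) [MOD 2] ∧
      W (3 * n) ≡ Z n * (X n + X n * Y n + Y n) [MOD 2] ∧
      W (3 * n + 1) ≡ Z (n + 1) * (X n + X n * Y n + Y n) [MOD 2] ∧
      W (3 * n + 2) ≡ Z (n + 1) [MOD 2] := by
  open HankelParity in
  intro n hn
  obtain ⟨m, rfl⟩ : ∃ m, n = m + 1 := ⟨n - 1, by omega⟩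
  have det_iff := det_ne_zero_iff_blockSystem indicator_K3_three_mul
    indicator_K3_three_mul_add_one indicator_K3_three_mul_add_two
  have detSum_iff := detSum_ne_zero_iff_blockSystem indicator_K3_three_mul
    indicator_K3_three_mul_add_one indicator_K3_three_mul_add_two
  have last_iff := last_ne_zero_iff_blockSystem indicator_K3_three_mul
    indicator_K3_three_mul_add_one indicator_K3_three_mul_add_two
  have or_iff : ∀ s t : ZMod 2, s + s * t + t ≠ 0 ↔ s ≠ 0 ∨ t ≠ 0 := by decide
  simp only [modEq_two_iff, U, V, W, X, Y, Z, Nat.cast_add, Nat.cast_mul,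
    cast_sum_permCount, cast_permCount, mul_ne_zero_iff, or_iff, Nat.add_sub_cancel]
  have d0 : ∀ k, 3 * k / 3 = k := by omega
  have d1 : ∀ k, (3 * k + 1) / 3 = k := by omega
  have d2 : ∀ k, (3 * k + 2) / 3 = k := by omega
  have d3 : ∀ k, (3 * k + 3) / 3 = k + 1 := by omega
  have d4 : ∀ k, (3 * k + 4) / 3 = k + 1 := by omega
  refine ⟨?_, ?_, ?_, ?_, ?_, ?_, ?_, ?_, ?_⟩
  · rw [detSum_iff]
    simpa only [d0, d1, d2] using square_bordered_system_iff _ (m + 1)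
  · rw [det_iff]
    simpa only [d0, d1, d2] using square_system_iff _ (m + 1)
  · rw [detSum_iff]
    simpa only [add_assoc, Nat.reduceAdd, d1, d2, d3] using
      wide_bordered_system_iff _ (m + 1) (m + 1)
  · rw [det_iff]
    simpa only [add_assoc, Nat.reduceAdd, d1, d2, d3] using wide_system_iff _ (m + 1) (m + 1)
  · rw [detSum_iff]
    simpa only [add_assoc, Nat.reduceAdd, d2, d3, d4] using
      wide_bordered_system_iff _ (m + 1) (m + 1 + 1)
  · rw [det_iff]
    simpa only [add_assoc, Nat.reduceAdd, d2, d3, d4] using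
      wide_system_iff _ (m + 1) (m + 1 + 1)
  · rw [show 3 * (m + 1) = 3 * m + 2 + 1 by ring, Nat.add_sub_cancel, last_iff]
    simpa only [add_assoc, Nat.reduceAdd, d2, d3, d4,
      show (3 * m + 5) / 3 = m + 1 by omega] using short_system_iff _ m (m + 1)
  · rw [last_iff]
    simpa only [add_assoc, Nat.reduceAdd, d0, d1, d2, d3] using
      short_system_iff _ (m + 1) (m + 1)
  · rw [show 3 * (m + 1) + 2 - 1 = 3 * (m + 1) + 1 from rfl, last_iff (3 * (m + 1) + 1)]
    simpa only [add_assoc, Nat.reduceAdd, d1, d2, d3, d4] using wide_short_system_iff _ (m + 1)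
end
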